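/- arXiv:1405.3327 — 3 statements merged into one kernel-verified Lean document; each statement's English description precedes it below -/
import Mathlib

section
/- Let ψ be a bounded perturbation of a strictly convex potential. Then there exist ρ > 0 and c ≥ 0, depending only on ψ (independent of N, m and a), such that for every N ∈ ℕ, every m ∈ ℝ and every a ∈ ℝ^N, the canonical ensemble μ_{N,a,m} satisfies the logarithmic Sobolev inequality LSI(ρ e^{−cN}). -/
open MeasureTheory ENNReal Real

noncomputable section

/-- The canonical ensemble `μ_{N,a,m}`: the probability measure on the hyperplane
`X_{N,m} = {x : (1/N)∑ xᵢ = m}` with density `Z⁻¹ exp(-∑ (ψ(xᵢ) + aᵢxᵢ))` with respect to the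
`(N-1)`-dimensional Hausdorff measure on that hyperplane. -/
def canonEns (ψ : ℝ → ℝ) (N : ℕ) (a : Fin N → ℝ) (m : ℝ) :
    Measure (EuclideanSpace ℝ (Fin N)) :=
  let ν : Measure (EuclideanSpace ℝ (Fin N)) :=
    ((μH[(N : ℝ) - 1]).restrict {x : EuclideanSpace ℝ (Fin N) | ∑ i, x i = (N : ℝ) * m}).withDensity
      fun x => ENNReal.ofReal (Real.exp (-(∑ i, (ψ (x i) + a i * x i))))
  (ν Set.univ)⁻¹ • ν

/-- Entropy `Ent_μ(f) = ∫ f log f dμ - (∫ f dμ) log (∫ f dμ)`. -/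
def entFor {X : Type*} [MeasurableSpace X] (μ : Measure X) (f : X → ℝ) : ℝ :=
  (∫ x, f x * Real.log (f x) ∂μ) - (∫ x, f x ∂μ) * Real.log (∫ x, f x ∂μ)

/-- `|∇f|²/f` where `∇f` is the projection of the Euclidean gradient onto the mean-zero
subspace `{v : ∑ vᵢ = 0}`, interpreted as `0` where `f = 0`. -/
def fisherX (N : ℕ) (f : EuclideanSpace ℝ (Fin N) → ℝ) (x : EuclideanSpace ℝ (Fin N)) : ℝ :=
  if f x = 0 then 0
  else (∑ i, (gradient f x i - (∑ j, gradient f x j) / (N : ℝ)) ^ 2) / f x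

/-- The logarithmic Sobolev inequality `LSI(ρ)` for a measure supported on the hyperplane
`X_{N,m} ⊆ ℝ^N`. -/
def IsLSI (N : ℕ) (μ : Measure (EuclideanSpace ℝ (Fin N))) (ρ : ℝ) : Prop :=
  ∀ f : EuclideanSpace ℝ (Fin N) → ℝ, ContDiff ℝ (⊤ : ℕ∞) f → (∀ x, 0 ≤ f x) →
    Integrable f μ → Integrable (fun x => f x * Real.log (f x)) μ →
    Integrable (fisherX N f) μ →
    entFor μ f ≤ (1 / ρ) * ∫ x, fisherX N f x ∂μ

open scoped Pointwise in
theorem volume_image_mul_add (K : Set ℝ) {t : ℝ} (ht : 0 < t) (c : ℝ) :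
    volume ((fun x => t * x + c) '' K) = ENNReal.ofReal t * volume K := by
  have : (fun x => t * x + c) '' K = (fun x => x + c) '' (t • K) := by
    rw [← Set.image_smul, Set.image_image]; simp
  rw [this, Set.image_add_right, measure_preimage_add_right, Measure.addHaar_smul]
  simp [abs_of_pos ht]

/-- One-dimensional Brunn–Minkowski inequality for compact sets. -/
theorem brunnMinkowski_of_isCompact {K L C : Set ℝ} (hK : IsCompact K) (hL : IsCompact L)
    (hK0 : K.Nonempty) (hL0 : L.Nonempty) {t s : ℝ} (ht : 0 < t) (hs : 0 < s)
    (h : ∀ x ∈ K, ∀ y ∈ L, t * x + s * y ∈ C) :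
    ENNReal.ofReal t * volume K + ENNReal.ofReal s * volume L ≤ volume C := by
  have ha := hK.sSup_mem hK0
  have hb := hL.sInf_mem hL0
  set a := sSup K
  set b := sInf L
  have hKa : ∀ x ∈ K, x ≤ a := fun x hx => le_csSup hK.bddAbove hx
  have hLb : ∀ y ∈ L, b ≤ y := fun y hy => csInf_le hL.bddBelow hy
  have hmL : MeasurableSet ((fun y => s * y + t * a) '' L) :=
    (hL.image (by fun_prop)).measurableSet
  have hdisj : AEDisjoint volume ((fun x => t * x + s * b) '' K)
      ((fun y => s * y + t * a) '' L) := by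
    refine measure_mono_null (t := {t * a + s * b}) ?_ (by simp)
    rintro _ ⟨⟨x, hx, rfl⟩, ⟨y, hy, hxy⟩⟩
    have h1 := mul_le_mul_of_nonneg_left (hKa x hx) ht.le
    have h2 := mul_le_mul_of_nonneg_left (hLb y hy) hs.le
    simp only [Set.mem_singleton_iff] at hxy ⊢
    linarith
  rw [← volume_image_mul_add K ht (s * b), ← volume_image_mul_add L hs (t * a),
    ← measure_union₀ hmL.nullMeasurableSet hdisj]
  refine measure_mono (Set.union_subset ?_ ?_)
  · rintro _ ⟨x, hx, rfl⟩
    exact h x hx b hb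
  · rintro _ ⟨y, hy, rfl⟩
    simpa [add_comm] using h a ha y hy

/-- One-dimensional Brunn–Minkowski inequality. -/
theorem brunnMinkowski_real {A B C : Set ℝ} (hA : MeasurableSet A) (hB : MeasurableSet B)
    (hA0 : A.Nonempty) (hB0 : B.Nonempty) {t s : ℝ} (ht : 0 < t) (hs : 0 < s)
    (h : ∀ x ∈ A, ∀ y ∈ B, t * x + s * y ∈ C) :
    ENNReal.ofReal t * volume A + ENNReal.ofReal s * volume B ≤ volume C := by
  obtain ⟨a, ha⟩ := hA0
  obtain ⟨b, hb⟩ := hB0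
  rw [hA.measure_eq_iSup_isCompact, hB.measure_eq_iSup_isCompact]
  simp only [ENNReal.mul_iSup, iSup_and']
  refine ENNReal.biSup_add_biSup_le' ⟨∅, by simp⟩ ⟨∅, by simp⟩ ?_
  rintro K ⟨hKA, hK⟩ L ⟨hLB, hL⟩
  refine le_trans ?_ (brunnMinkowski_of_isCompact (hK.insert a) (hL.insert b)
    (Set.insert_nonempty a K) (Set.insert_nonempty b L) ht hs fun x hx y hy => h x ?_ y ?_)
  · gcongr <;> exact Set.subset_insert _ _
  · exact Set.insert_subset ha hKA hx
  · exact Set.insert_subset hb hLB hy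

/-- Weighted arithmetic-geometric mean inequality in `ℝ≥0∞`. -/
theorem ennreal_geom_mean_le_arith_mean (a b : ℝ≥0∞) {t s : ℝ} (ht : 0 < t) (hs : 0 < s)
    (hts : t + s = 1) : a ^ t * b ^ s ≤ ENNReal.ofReal t * a + ENNReal.ofReal s * b := by
  have hpq : (1 / t).HolderConjugate (1 / s) := by
    rw [Real.holderConjugate_iff]
    refine ⟨by rw [lt_div_iff₀ ht]; linarith, by simpa using hts⟩
  have hdiv : ∀ (x : ℝ≥0∞) {r : ℝ}, 0 < r → x / ENNReal.ofReal (1 / r) = ENNReal.ofReal r * x :=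
    fun x r hr => by
      rw [div_eq_mul_inv, ← ENNReal.ofReal_inv_of_pos (by positivity), one_div, inv_inv, mul_comm]
  have := ENNReal.young_inequality (a ^ t) (b ^ s) hpq
  rwa [← ENNReal.rpow_mul, ← ENNReal.rpow_mul, mul_one_div_cancel ht.ne',
    mul_one_div_cancel hs.ne', ENNReal.rpow_one, ENNReal.rpow_one, hdiv a ht, hdiv b hs] at this

theorem lintegral_eq_setLIntegral_Ioo_meas_lt {f : ℝ → ℝ} (hf : Measurable f) (hf0 : ∀ x, 0 ≤ f x)
    (hf1 : ∀ x, f x ≤ 1) :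
    ∫⁻ x, ENNReal.ofReal (f x) = ∫⁻ l in Set.Ioo (0 : ℝ) 1, volume {x | l < f x} := by
  rw [lintegral_eq_lintegral_meas_lt volume (Filter.Eventually.of_forall hf0) hf.aemeasurable,
    ← Set.Ioo_union_Ici_eq_Ioi (zero_lt_one' ℝ), lintegral_union measurableSet_Ici]
  · rw [setLIntegral_congr_fun (g := fun _ => 0) measurableSet_Ici, lintegral_zero, add_zero]
    intro l hl
    have : {x | l < f x} = ∅ := by
      ext x; simpa using (hf1 x).trans hl
    simp [this]
  · exact Set.disjoint_left.2 fun x hx hx' => absurd hx.2 (not_lt.2 hx')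

/-- Prékopa–Leindler inequality on the line, for functions with supremum one. -/
theorem prekopaLeindler_real_normalized {u v w : ℝ → ℝ} (hu : Measurable u) (hv : Measurable v)
    (hw : Measurable w) (hu0 : ∀ x, 0 ≤ u x) (hv0 : ∀ x, 0 ≤ v x) (hw0 : ∀ x, 0 ≤ w x)
    (hu1 : ∀ x, u x ≤ 1) (hv1 : ∀ x, v x ≤ 1) (hus : ∀ l < 1, ∃ x, l < u x)
    (hvs : ∀ l < 1, ∃ x, l < v x) {t s : ℝ} (ht : 0 < t) (hs : 0 < s) (hts : t + s = 1)
    (h : ∀ x y, u x ^ t * v y ^ s ≤ w (t * x + s * y)) :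
    (∫⁻ x, ENNReal.ofReal (u x)) ^ t * (∫⁻ x, ENNReal.ofReal (v x)) ^ s ≤
      ∫⁻ x, ENNReal.ofReal (w x) := by
  refine (ennreal_geom_mean_le_arith_mean _ _ ht hs hts).trans ?_
  have hmeas : ∀ f : ℝ → ℝ, Measurable fun l : ℝ => volume {x | l < f x} := fun f =>
    Antitone.measurable fun a b hab => measure_mono fun x hx => lt_of_le_of_lt hab hx
  rw [lintegral_eq_setLIntegral_Ioo_meas_lt hu hu0 hu1,
    lintegral_eq_setLIntegral_Ioo_meas_lt hv hv0 hv1,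
    lintegral_eq_lintegral_meas_lt volume (Filter.Eventually.of_forall hw0) hw.aemeasurable,
    ← lintegral_const_mul _ (hmeas u), ← lintegral_const_mul _ (hmeas v),
    ← lintegral_add_left ((hmeas u).const_mul _)]
  refine le_trans ?_ (lintegral_mono_set (show Set.Ioo (0 : ℝ) 1 ⊆ Set.Ioi 0 from Set.Ioo_subset_Ioi_self))
  refine setLIntegral_mono (hmeas w) fun l hl => ?_
  refine brunnMinkowski_real (measurableSet_lt measurable_const hu)
    (measurableSet_lt measurable_const hv) (hus l hl.2) (hvs l hl.2) ht hs fun x hx y hy => ?_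
  refine lt_of_lt_of_le ?_ (h x y)
  calc l = l ^ t * l ^ s := by rw [← Real.rpow_add hl.1, hts, Real.rpow_one]
    _ < u x ^ t * v y ^ s := by
      have h1 := Real.rpow_lt_rpow hl.1.le hx ht
      have h2 := Real.rpow_lt_rpow hl.1.le hy hs
      exact mul_lt_mul'' h1 h2 (Real.rpow_nonneg hl.1.le _) (Real.rpow_nonneg hl.1.le _)

/-- Prékopa–Leindler inequality on the line, for bounded functions. -/
theorem prekopaLeindler_real_of_bounded {u v w : ℝ → ℝ} (hu : Measurable u) (hv : Measurable v)
    (hw : Measurable w) (hu0 : ∀ x, 0 ≤ u x) (hv0 : ∀ x, 0 ≤ v x) (hw0 : ∀ x, 0 ≤ w x)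
    {k : ℝ} (huk : ∀ x, u x ≤ k) (hvk : ∀ x, v x ≤ k)
    {t s : ℝ} (ht : 0 < t) (hs : 0 < s) (hts : t + s = 1)
    (h : ∀ x y, u x ^ t * v y ^ s ≤ w (t * x + s * y)) :
    (∫⁻ x, ENNReal.ofReal (u x)) ^ t * (∫⁻ x, ENNReal.ofReal (v x)) ^ s ≤
      ∫⁻ x, ENNReal.ofReal (w x) := by
  have hub : BddAbove (Set.range u) := ⟨k, by rintro _ ⟨x, rfl⟩; exact huk x⟩
  have hvb : BddAbove (Set.range v) := ⟨k, by rintro _ ⟨x, rfl⟩; exact hvk x⟩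
  set a := ⨆ x, u x
  set b := ⨆ x, v x
  have hua : ∀ x, u x ≤ a := le_ciSup hub
  have hvb : ∀ x, v x ≤ b := le_ciSup hvb
  rcases ((hu0 0).trans (hua 0)).eq_or_lt with ha | ha
  · have : ∀ x, u x = 0 := fun x => le_antisymm (ha ▸ hua x) (hu0 x)
    simp [this, ENNReal.zero_rpow_of_pos ht]
  rcases ((hv0 0).trans (hvb 0)).eq_or_lt with hb | hb
  · have : ∀ x, v x = 0 := fun x => le_antisymm (hb ▸ hvb x) (hv0 x)
    simp [this, ENNReal.zero_rpow_of_pos hs]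
  set c := a ^ t * b ^ s
  have hc : 0 < c := by positivity
  have key := prekopaLeindler_real_normalized (u := fun x => u x / a) (v := fun x => v x / b)
    (w := fun x => w x / c) (hu.div_const _) (hv.div_const _) (hw.div_const _)
    (fun x => div_nonneg (hu0 x) ha.le) (fun x => div_nonneg (hv0 x) hb.le)
    (fun x => div_nonneg (hw0 x) hc.le) (fun x => (div_le_one ha).2 (hua x))
    (fun x => (div_le_one hb).2 (hvb x))
    (fun l hl => by
      obtain ⟨x, hx⟩ := exists_lt_of_lt_ciSup (show l * a < ⨆ x, u x by
        change l * a < a; nlinarith)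
      exact ⟨x, (lt_div_iff₀ ha).2 hx⟩)
    (fun l hl => by
      obtain ⟨x, hx⟩ := exists_lt_of_lt_ciSup (show l * b < ⨆ x, v x by
        change l * b < b; nlinarith)
      exact ⟨x, (lt_div_iff₀ hb).2 hx⟩) ht hs hts
    (fun x y => by
      rw [Real.div_rpow (hu0 x) ha.le, Real.div_rpow (hv0 y) hb.le, div_mul_div_comm]
      exact div_le_div_of_nonneg_right (h x y) hc.le)
  have hdiv : ∀ {f : ℝ → ℝ} {d : ℝ}, Measurable f → 0 < d →
      ∫⁻ x, ENNReal.ofReal (f x / d) = (ENNReal.ofReal d)⁻¹ * ∫⁻ x, ENNReal.ofReal (f x) := by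
    intro f d hf hd
    rw [← lintegral_const_mul _ hf.ennreal_ofReal]
    refine lintegral_congr fun x => ?_
    rw [ENNReal.ofReal_div_of_pos hd, div_eq_mul_inv, mul_comm]
  rw [hdiv hu ha, hdiv hv hb, hdiv hw hc, ENNReal.mul_rpow_of_nonneg _ _ ht.le,
    ENNReal.mul_rpow_of_nonneg _ _ hs.le, mul_mul_mul_comm, ENNReal.inv_rpow, ENNReal.inv_rpow,
    ENNReal.ofReal_rpow_of_pos ha, ENNReal.ofReal_rpow_of_pos hb,
    ← ENNReal.ofReal_inv_of_pos (by positivity), ← ENNReal.ofReal_inv_of_pos (by positivity),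
    ← ENNReal.ofReal_mul (by positivity), ← mul_inv, ENNReal.ofReal_inv_of_pos hc] at key
  exact (ENNReal.mul_le_mul_iff_right (by simp) (by simpa using hc)).1 key

/-- A measure on a real vector space satisfies the Prékopa–Leindler inequality. -/
def PrekopaLeindler {E : Type*} [AddCommGroup E] [Module ℝ E] [MeasurableSpace E]
    (μ : Measure E) : Prop :=
  ∀ (u v w : E → ℝ≥0∞), Measurable u → Measurable v → Measurable w →
    ∀ t s : ℝ, 0 < t → 0 < s → t + s = 1 →
    (∀ x y, u x ^ t * v y ^ s ≤ w (t • x + s • y)) →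
    (∫⁻ x, u x ∂μ) ^ t * (∫⁻ x, v x ∂μ) ^ s ≤ ∫⁻ x, w x ∂μ

theorem tendsto_lintegral_min_natCast {α : Type*} [MeasurableSpace α] {μ : Measure α}
    {u : α → ℝ≥0∞} (hu : Measurable u) :
    Filter.Tendsto (fun k : ℕ => ∫⁻ x, min (u x) k ∂μ) Filter.atTop (nhds (∫⁻ x, u x ∂μ)) := by
  refine lintegral_tendsto_of_tendsto_of_monotone (fun k => (hu.min measurable_const).aemeasurable)
    (Filter.Eventually.of_forall fun x k l hkl => min_le_min_left _ (by exact_mod_cast hkl))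
    (Filter.Eventually.of_forall fun x => ?_)
  have := (tendsto_const_nhds (x := u x)).min ENNReal.tendsto_nat_nhds_top
  simpa using this

/-- Prékopa–Leindler inequality on the line. -/
theorem prekopaLeindler_volume_real : PrekopaLeindler (volume : Measure ℝ) := by
  intro u v w hu hv hw t s ht hs hts h
  by_cases hu0 : ∫⁻ x, u x = 0
  · simp [hu0, ENNReal.zero_rpow_of_pos ht]
  by_cases hv0 : ∫⁻ x, v x = 0
  · simp [hv0, ENNReal.zero_rpow_of_pos hs]
  refine le_of_tendsto (ENNReal.Tendsto.mul
    ((ENNReal.continuous_rpow_const.tendsto _).comp (tendsto_lintegral_min_natCast hu))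
    (Or.inl (by simp [ENNReal.rpow_eq_zero_iff, hu0, not_lt.2 ht.le]))
    ((ENNReal.continuous_rpow_const.tendsto _).comp (tendsto_lintegral_min_natCast hv))
    (Or.inl (by simp [ENNReal.rpow_eq_zero_iff, hv0, not_lt.2 hs.le])))
    (Filter.Eventually.of_forall fun k => ?_)
  have hfin : ∀ a : ℝ≥0∞, min a (k : ℝ≥0∞) ≠ ∞ := fun a =>
    ne_top_of_le_ne_top (ENNReal.natCast_ne_top k) (min_le_right _ _)
  have hle : ∀ a : ℝ≥0∞, (min a (k : ℝ≥0∞)).toReal ≤ k := fun a => by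
    simpa using ENNReal.toReal_mono (ENNReal.natCast_ne_top k) (min_le_right a _)
  have key := prekopaLeindler_real_of_bounded (u := fun x => (min (u x) k).toReal)
    (v := fun x => (min (v x) k).toReal) (w := fun x => (min (w x) k).toReal)
    (hu.min measurable_const).ennreal_toReal (hv.min measurable_const).ennreal_toReal
    (hw.min measurable_const).ennreal_toReal (fun _ => toReal_nonneg) (fun _ => toReal_nonneg)
    (fun _ => toReal_nonneg) (fun x => hle _) (fun x => hle _) ht hs hts (fun x y => by
      rw [ENNReal.toReal_rpow, ENNReal.toReal_rpow, ← ENNReal.toReal_mul]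
      refine ENNReal.toReal_mono (hfin _) (le_min ?_ ?_)
      · refine le_trans ?_ (h x y)
        gcongr <;> exact min_le_left _ _
      · calc min (u x) (k : ℝ≥0∞) ^ t * min (v y) (k : ℝ≥0∞) ^ s
            ≤ (k : ℝ≥0∞) ^ t * (k : ℝ≥0∞) ^ s := by gcongr <;> exact min_le_right _ _
          _ = k := by
            rw [← ENNReal.rpow_add_of_nonneg _ _ ht.le hs.le, hts, ENNReal.rpow_one])
  simp only [ENNReal.ofReal_toReal (hfin _)] at key
  exact key.trans (lintegral_mono fun x => min_le_left _ _)

theorem PrekopaLeindler.prod {E F : Type*} [AddCommGroup E] [Module ℝ E] [MeasurableSpace E]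
    [AddCommGroup F] [Module ℝ F] [MeasurableSpace F] {μ : Measure E} {ν : Measure F}
    [SFinite ν] [SFinite μ] (hμ : PrekopaLeindler μ) (hν : PrekopaLeindler ν) :
    PrekopaLeindler (μ.prod ν) := by
  intro u v w hu hv hw t s ht hs hts h
  rw [lintegral_prod _ hu.aemeasurable, lintegral_prod _ hv.aemeasurable,
    lintegral_prod _ hw.aemeasurable]
  refine hμ _ _ _ hu.lintegral_prod_right' hv.lintegral_prod_right' hw.lintegral_prod_right'
    t s ht hs hts fun x y => ?_
  exact hν _ _ _ (hu.comp measurable_prodMk_left) (hv.comp measurable_prodMk_left)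
    (hw.comp measurable_prodMk_left) t s ht hs hts fun x' y' => h (x, x') (y, y')

theorem PrekopaLeindler.of_measurePreserving {E F : Type*} [AddCommGroup E] [Module ℝ E]
    [MeasurableSpace E] [AddCommGroup F] [Module ℝ F] [MeasurableSpace F] {μ : Measure E}
    {ν : Measure F} (hμ : PrekopaLeindler μ) (e : E →ₗ[ℝ] F) (he : MeasurePreserving e μ ν) :
    PrekopaLeindler ν := by
  intro u v w hu hv hw t s ht hs hts h
  rw [← he.lintegral_comp hu, ← he.lintegral_comp hv, ← he.lintegral_comp hw]
  exact hμ _ _ _ (hu.comp he.measurable) (hv.comp he.measurable) (hw.comp he.measurable)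
    t s ht hs hts fun x y => by simpa using h (e x) (e y)

/-- Prékopa–Leindler inequality on `Fin n → ℝ`. -/
theorem prekopaLeindler_volume_pi (n : ℕ) : PrekopaLeindler (volume : Measure (Fin n → ℝ)) := by
  induction n with
  | zero =>
    intro u v w hu hv hw t s ht hs hts h
    have h0 := h default default
    rw [Subsingleton.elim (t • default + s • default) (default : Fin 0 → ℝ)] at h0
    rw [Measure.volume_pi_eq_dirac (default : Fin 0 → ℝ)]
    simpa only [lintegral_dirac] using h0
  | succ n ih =>
    refine (prekopaLeindler_volume_real.prod ih).of_measurePreserving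
      (F := Fin (n + 1) → ℝ) (Fin.consLinearEquiv ℝ (fun _ : Fin (n + 1) => ℝ)).toLinearMap ?_
    have := (volume_preserving_piFinSuccAbove (fun _ : Fin (n + 1) => ℝ) 0).symm
    convert this using 1
    · ext p i
      refine Fin.cases ?_ (fun j => ?_) i <;> simp [Fin.consLinearEquiv, Fin.consEquiv]
    · rfl

/-- Prékopa–Leindler inequality on Euclidean space. -/
theorem prekopaLeindler_volume_euclideanSpace (n : ℕ) :
    PrekopaLeindler (volume : Measure (EuclideanSpace ℝ (Fin n))) :=
  (prekopaLeindler_volume_pi n).of_measurePreserving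
    (WithLp.linearEquiv 2 ℝ (Fin n → ℝ)).symm.toLinearMap (PiLp.volume_preserving_toLp (Fin n))

/-- `y log (y / c) - y + c`, the integrand of the relative entropy with reference value `c`. -/
def entropyIntegrand (c y : ℝ) : ℝ := y * Real.log y - y * Real.log c - y + c

theorem entropyIntegrand_nonneg {c y : ℝ} (hc : 0 < c) (hy : 0 ≤ y) : 0 ≤ entropyIntegrand c y := by
  rcases hy.eq_or_lt with rfl | hy
  · simpa [entropyIntegrand] using hc.le
  · have h := Real.log_le_sub_one_of_pos (div_pos hc hy)
    rw [Real.log_div hc.ne' hy.ne'] at h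
    have := mul_le_mul_of_nonneg_left h hy.le
    have h2 : y * (c / y) = c := by field_simp
    unfold entropyIntegrand
    nlinarith

section StronglyLogConcave

variable {E : Type*} [NormedAddCommGroup E] [NormedSpace ℝ E]

theorem le_add_norm_fderiv_mul_add {g : E → ℝ} (hg : Differentiable ℝ g) {L : NNReal}
    (hL : LipschitzWith L (fderiv ℝ g)) (z h : E) :
    g (z + h) ≤ g z + ‖fderiv ℝ g z‖ * ‖h‖ + L * ‖h‖ ^ 2 := by
  have key := (convex_closedBall z ‖h‖).norm_image_sub_le_of_norm_fderiv_le' (𝕜 := ℝ) (f := g)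
    (φ := fderiv ℝ g z) (C := L * ‖h‖) (fun x _ => hg x)
    (fun x hx => by
      have := hL.dist_le_mul x z
      rw [dist_eq_norm] at this
      exact this.trans (mul_le_mul_of_nonneg_left (Metric.mem_closedBall.1 hx) L.2))
    (Metric.mem_closedBall_self (norm_nonneg h)) (y := z + h) (by simp)
  rw [add_sub_cancel_left, Real.norm_eq_abs] at key
  have h1 := (abs_le.1 key).2
  have h2 := (le_abs_self _).trans ((fderiv ℝ g z).le_opNorm h)
  nlinarith

/-- Strong convexity, with an explicit quadratic modulus. -/
def StronglyConvex (lam : ℝ) (V : E → ℝ) : Prop :=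
  ∀ x y : E, ∀ t s : ℝ, 0 < t → 0 < s → t + s = 1 →
    V (t • x + s • y) ≤ t * V x + s * V y - lam / 2 * (t * s) * ‖x - y‖ ^ 2

theorem inf_convolution_bound {V g : E → ℝ} {lam : ℝ} (hV : StronglyConvex lam V)
    (hg : Differentiable ℝ g) {L : NNReal} (hL : LipschitzWith L (fderiv ℝ g)) {t s : ℝ}
    (ht : 0 < t) (hs : 0 < s) (hts : t + s = 1) (hpos : 0 < lam * t - 2 * L * s) (x y : E) :
    g x - t * V x - s * V y ≤ g (t • x + s • y) +
      s / (2 * (lam * t - 2 * L * s)) * ‖fderiv ℝ g (t • x + s • y)‖ ^ 2 - V (t • x + s • y) := by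
  have h1 := hV x y t s ht hs hts
  have h2 := le_add_norm_fderiv_mul_add hg hL (t • x + s • y) (s • (x - y))
  have h3 : t • x + s • y + s • (x - y) = x := by
    obtain rfl : t = 1 - s := by linarith
    module
  rw [h3, norm_smul, Real.norm_of_nonneg hs.le] at h2
  set d := ‖fderiv ℝ g (t • x + s • y)‖
  set r := ‖x - y‖
  set q := lam * t - 2 * L * s
  have h4 : d * (s * r) - s * q / 2 * r ^ 2 ≤ s / (2 * q) * d ^ 2 := by
    have : s / (2 * q) * d ^ 2 - (d * (s * r) - s * q / 2 * r ^ 2) =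
        s / (2 * q) * (d - q * r) ^ 2 := by field_simp; ring
    have : 0 ≤ s / (2 * q) * (d - q * r) ^ 2 := by positivity
    linarith
  have h5 : s * q / 2 * r ^ 2 = lam / 2 * (t * s) * r ^ 2 - L * (s * r) ^ 2 := by
    simp only [q]; ring
  linarith

variable [MeasurableSpace E] [BorelSpace E]

theorem prekopaLeindler_gibbs {μ : Measure E} (hμ : PrekopaLeindler μ) {V g : E → ℝ} {lam : ℝ}
    (hVc : Continuous V) (hV : StronglyConvex lam V)
    (hg : Differentiable ℝ g) {L : NNReal} (hL : LipschitzWith L (fderiv ℝ g)) {t s : ℝ}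
    (ht : 0 < t) (hs : 0 < s) (hts : t + s = 1) (hpos : 0 < lam * t - 2 * L * s) :
    (∫⁻ x, ENNReal.ofReal (rexp (g x / t))
        ∂(μ.withDensity fun x => ENNReal.ofReal (rexp (-V x)))) ^ t *
      (μ.withDensity (fun x => ENNReal.ofReal (rexp (-V x))) Set.univ) ^ s ≤
    ∫⁻ x, ENNReal.ofReal (rexp (g x + s / (2 * (lam * t - 2 * L * s)) * ‖fderiv ℝ g x‖ ^ 2))
        ∂(μ.withDensity fun x => ENNReal.ofReal (rexp (-V x))) := by
  have hgm : Measurable g := hg.continuous.measurable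
  have hdm : Measurable fun x => ‖fderiv ℝ g x‖ := hL.continuous.norm.measurable
  have hVm := hVc.measurable
  rw [lintegral_withDensity_eq_lintegral_mul _ (by fun_prop) (by fun_prop),
    lintegral_withDensity_eq_lintegral_mul _ (by fun_prop) (by fun_prop),
    withDensity_apply _ MeasurableSet.univ, Measure.restrict_univ]
  refine hμ _ _ _ (by fun_prop) (by fun_prop) (by fun_prop) t s ht hs hts fun x y => ?_
  simp only [Pi.mul_apply]
  rw [← ENNReal.ofReal_mul (exp_nonneg _), ← ENNReal.ofReal_mul (exp_nonneg _), ← Real.exp_add,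
    ← Real.exp_add, ENNReal.ofReal_rpow_of_pos (exp_pos _), ENNReal.ofReal_rpow_of_pos (exp_pos _),
    ← Real.exp_mul, ← Real.exp_mul, ← ENNReal.ofReal_mul (exp_nonneg _), ← Real.exp_add]
  refine ENNReal.ofReal_le_ofReal (Real.exp_le_exp.2 ?_)
  have := inf_convolution_bound hV hg hL ht hs hts hpos x y
  have h2 : (-V x + g x / t) * t + -V y * s = g x - t * V x - s * V y := by
    field_simp; ring
  rw [h2]
  linarith

end StronglyLogConcave

/-- A quantitative consequence of the convexity of the exponential. -/
theorem log_integral_exp_div_ge {X : Type*} [MeasurableSpace X] {ν : Measure X} [IsFiniteMeasure ν]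
    {g : X → ℝ} {t s : ℝ} (ht : 0 < t) (hts : t + s = 1)
    (hg0 : Integrable (fun x => rexp (g x)) ν) (hg1 : Integrable (fun x => g x * rexp (g x)) ν)
    (hg2 : Integrable (fun x => rexp (g x / t)) ν) (hZ : 0 < ∫ x, rexp (g x) ∂ν) :
    t * Real.log (∫ x, rexp (g x) ∂ν) + s * ((∫ x, g x * rexp (g x) ∂ν) / ∫ x, rexp (g x) ∂ν) ≤
      t * Real.log (∫ x, rexp (g x / t) ∂ν) := by
  set Z := ∫ x, rexp (g x) ∂ν
  set G := ∫ x, g x * rexp (g x) ∂ν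
  set q := s / t * (G / Z)
  have hpt : ∀ x, rexp q * ((1 - q) * rexp (g x) + s / t * (g x * rexp (g x))) ≤
      rexp (g x / t) := fun x => by
    have h1 : g x / t = g x + q + (s / t * g x - q) := by
      have : s = 1 - t := by linarith
      rw [this]; field_simp; ring
    rw [h1, Real.exp_add, Real.exp_add]
    have h2 := Real.add_one_le_exp (s / t * g x - q)
    calc _ = rexp (g x) * rexp q * (s / t * g x - q + 1) := by ring
      _ ≤ _ := mul_le_mul_of_nonneg_left h2 (by positivity)
  have hint := integral_mono
    (((hg0.const_mul (1 - q)).add (hg1.const_mul (s / t))).const_mul (rexp q)) hg2 hpt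
  rw [integral_const_mul] at hint
  have hsum : ∫ x, ((fun x => (1 - q) * rexp (g x)) + fun x => s / t * (g x * rexp (g x))) x ∂ν
      = Z := by
    rw [integral_add' (hg0.const_mul _) (hg1.const_mul _), integral_const_mul, integral_const_mul]
    change (1 - q) * Z + s / t * G = Z
    simp only [q]; field_simp; ring
  rw [hsum] at hint
  have h3 := Real.log_le_log (by positivity) hint
  rw [Real.log_mul (exp_pos _).ne' hZ.ne', Real.log_exp] at h3
  have h4 := mul_le_mul_of_nonneg_left h3 ht.le
  have h5 : t * q = s * (G / Z) := by simp only [q]; field_simp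
  rw [mul_add, h5] at h4
  linarith

theorem log_integral_exp_add_le {X : Type*} [MeasurableSpace X] {ν : Measure X} [IsFiniteMeasure ν]
    {g d : X → ℝ} {κ A : ℝ} (hκ : 0 ≤ κ) (hd0 : ∀ x, 0 ≤ d x) (hdA : ∀ x, d x ≤ A)
    (hκA : κ * A ≤ 1)
    (hg0 : Integrable (fun x => rexp (g x)) ν) (hg1 : Integrable (fun x => d x * rexp (g x)) ν)
    (hg2 : Integrable (fun x => rexp (g x + κ * d x)) ν) (hZ : 0 < ∫ x, rexp (g x) ∂ν) :
    Real.log (∫ x, rexp (g x + κ * d x) ∂ν) ≤ Real.log (∫ x, rexp (g x) ∂ν) +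
      κ * ((∫ x, d x * rexp (g x) ∂ν) / ∫ x, rexp (g x) ∂ν) + (κ * A) ^ 2 := by
  set Z := ∫ x, rexp (g x) ∂ν
  set F := ∫ x, d x * rexp (g x) ∂ν
  have hpt : ∀ x, rexp (g x + κ * d x) ≤
      (1 + (κ * A) ^ 2) * rexp (g x) + κ * (d x * rexp (g x)) := fun x => by
    have h0 : 0 ≤ κ * d x := mul_nonneg hκ (hd0 x)
    have h1 : κ * d x ≤ κ * A := mul_le_mul_of_nonneg_left (hdA x) hκ
    have h2 := (abs_le.1 (Real.abs_exp_sub_one_sub_id_le (x := κ * d x)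
      (by rw [abs_of_nonneg h0]; linarith))).2
    have h3 : (κ * d x) ^ 2 ≤ (κ * A) ^ 2 := pow_le_pow_left₀ h0 h1 2
    rw [Real.exp_add]
    have := mul_le_mul_of_nonneg_left (show rexp (κ * d x) ≤ 1 + κ * d x + (κ * A) ^ 2 by linarith)
      (exp_nonneg (g x))
    linarith
  have hint := integral_mono hg2 ((hg0.const_mul (1 + (κ * A) ^ 2)).add (hg1.const_mul κ)) hpt
  rw [integral_add' (hg0.const_mul _) (hg1.const_mul _), integral_const_mul,
    integral_const_mul] at hint
  have hpos : 0 < ∫ x, rexp (g x + κ * d x) ∂ν :=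
    hZ.trans_le (integral_mono hg0 hg2 fun x =>
      Real.exp_le_exp.2 (le_add_of_nonneg_right (mul_nonneg hκ (hd0 x))))
  have h4 : Real.log ((∫ x, rexp (g x + κ * d x) ∂ν) / Z) ≤ κ * (F / Z) + (κ * A) ^ 2 := by
    refine (Real.log_le_sub_one_of_pos (div_pos hpos hZ)).trans ?_
    rw [sub_le_iff_le_add, div_le_iff₀ hZ]
    refine hint.trans (le_of_eq ?_)
    change (1 + (κ * A) ^ 2) * Z + κ * F = _
    field_simp; ring
  rw [Real.log_div hpos.ne' hZ.ne'] at h4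
  linarith

section StronglyLogConcave

variable {E : Type*} [NormedAddCommGroup E] [NormedSpace ℝ E] [MeasurableSpace E] [BorelSpace E]

theorem entropy_exp_le_of_prekopaLeindler {μ : Measure E} (hμ : PrekopaLeindler μ) {V g : E → ℝ}
    {lam : ℝ} (hlam : 0 < lam) (hVc : Continuous V) (hV : StronglyConvex lam V)
    (hg : Differentiable ℝ g) {L : NNReal} (hL : LipschitzWith L (fderiv ℝ g)) {K A : ℝ}
    (hgK : ∀ x, |g x| ≤ K) (hA : ∀ x, ‖fderiv ℝ g x‖ ≤ A) {ν : Measure E}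
    (hν : ν = μ.withDensity fun x => ENNReal.ofReal (rexp (-V x))) [IsFiniteMeasure ν]
    (hν0 : ν ≠ 0) :
    ∫⁻ x, ENNReal.ofReal
        (entropyIntegrand ((∫ y, rexp (g y) ∂ν) / ν.real Set.univ) (rexp (g x))) ∂ν ≤
      ENNReal.ofReal (1 / (2 * lam)) *
        ∫⁻ x, ENNReal.ofReal (‖fderiv ℝ g x‖ ^ 2 * rexp (g x)) ∂ν := by
  have hgm : Measurable g := hg.continuous.measurable
  have hdm : Measurable fun x => ‖fderiv ℝ g x‖ := hL.continuous.norm.measurable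
  have hbdd : ∀ (f : E → ℝ) (C : ℝ), Measurable f → (∀ x, |f x| ≤ C) → Integrable f ν :=
    fun f C hf hC => Integrable.of_bound hf.aestronglyMeasurable C
      (Filter.Eventually.of_forall hC)
  have hA0 : 0 ≤ A := (norm_nonneg _).trans (hA 0)
  have hdA : ∀ x, ‖fderiv ℝ g x‖ ^ 2 ≤ A ^ 2 := fun x => pow_le_pow_left₀ (norm_nonneg _) (hA x) 2
  have hexp : ∀ x, rexp (g x) ≤ rexp K := fun x => Real.exp_le_exp.2 (abs_le.1 (hgK x)).2
  have i0 : Integrable (fun x => rexp (g x)) ν := hbdd _ (rexp K) (by fun_prop) fun x => by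
    rw [abs_of_pos (exp_pos _)]; exact hexp x
  have i1 : Integrable (fun x => g x * rexp (g x)) ν :=
    hbdd _ (K * rexp K) (by fun_prop) fun x => by
      rw [abs_mul, abs_of_pos (exp_pos _)]
      exact mul_le_mul (hgK x) (hexp x) (exp_nonneg _) ((abs_nonneg _).trans (hgK x))
  have i2 : Integrable (fun x => ‖fderiv ℝ g x‖ ^ 2 * rexp (g x)) ν :=
    hbdd _ (A ^ 2 * rexp K) (by fun_prop) fun x => by
      rw [abs_of_nonneg (by positivity)]
      exact mul_le_mul (hdA x) (hexp x) (exp_nonneg _) (by positivity)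
  have i3 : ∀ t : ℝ, 0 < t → Integrable (fun x => rexp (g x / t)) ν := fun t ht =>
    hbdd _ (rexp (K / t)) (by fun_prop) fun x => by
      rw [abs_of_pos (exp_pos _)]
      exact Real.exp_le_exp.2 (div_le_div_of_nonneg_right (abs_le.1 (hgK x)).2 ht.le)
  have i4 : ∀ κ : ℝ, 0 ≤ κ → Integrable (fun x => rexp (g x + κ * ‖fderiv ℝ g x‖ ^ 2)) ν :=
    fun κ hκ => hbdd _ (rexp (K + κ * A ^ 2)) (by fun_prop) fun x => by
      rw [abs_of_pos (exp_pos _)]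
      exact Real.exp_le_exp.2 (add_le_add (abs_le.1 (hgK x)).2
        (mul_le_mul_of_nonneg_left (hdA x) hκ))
  have : NeZero ν := ⟨hν0⟩
  set Z := ∫ x, rexp (g x) ∂ν
  set G := ∫ x, g x * rexp (g x) ∂ν
  set F := ∫ x, ‖fderiv ℝ g x‖ ^ 2 * rexp (g x) ∂ν
  set M := ν.real Set.univ
  have hM : 0 < M := by simp [M, Measure.real, ENNReal.toReal_pos_iff, pos_iff_ne_zero, hν0]
  have hZ : 0 < Z := integral_exp_pos i0
  let κ : ℝ → ℝ := fun s => 1 / (2 * (lam * (1 - s) - 2 * L * s))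
  have hκc : ContinuousAt κ 0 := by
    refine ContinuousAt.div (by fun_prop) (by fun_prop) ?_
    simp [hlam.ne']
  have hκ0 : κ 0 = 1 / (2 * lam) := by simp [κ]
  have hlim : Filter.Tendsto (fun s => κ s * (F / Z) + s * (κ s * A ^ 2) ^ 2)
      (nhdsWithin 0 (Set.Ioi 0)) (nhds (1 / (2 * lam) * (F / Z))) := by
    have : ContinuousAt (fun s => κ s * (F / Z) + s * (κ s * A ^ 2) ^ 2) 0 := by fun_prop
    have h := this.tendsto
    simp only [hκ0, zero_mul, add_zero] at h
    exact h.mono_left nhdsWithin_le_nhds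
  have e1 : ∀ᶠ s in nhdsWithin (0 : ℝ) (Set.Ioi 0), 0 < lam * (1 - s) - 2 * L * s := by
    refine Filter.Eventually.filter_mono nhdsWithin_le_nhds ?_
    refine ContinuousAt.eventually_lt (f := fun _ => (0 : ℝ)) (by fun_prop) (by fun_prop) ?_
    simpa using hlam
  have e2 : ∀ᶠ s in nhdsWithin (0 : ℝ) (Set.Ioi 0), s * κ s * A ^ 2 < 1 := by
    refine Filter.Eventually.filter_mono nhdsWithin_le_nhds ?_
    refine ContinuousAt.eventually_lt (g := fun _ => (1 : ℝ)) (by fun_prop) (by fun_prop) ?_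
    simp
  have e3 : ∀ᶠ s in nhdsWithin (0 : ℝ) (Set.Ioi 0), s < 1 :=
    Filter.Eventually.filter_mono nhdsWithin_le_nhds (eventually_lt_nhds zero_lt_one)
  have main : G / Z - Real.log Z + Real.log M ≤ 1 / (2 * lam) * (F / Z) := by
    refine ge_of_tendsto hlim ?_
    filter_upwards [e1, e2, e3, self_mem_nhdsWithin] with s h1 h2 h3 h4
    have hs : 0 < s := h4
    have ht : 0 < 1 - s := by linarith
    have hts : 1 - s + s = 1 := by ring
    have hκs : 0 ≤ κ s := by simp only [κ]; positivity
    have pl := prekopaLeindler_gibbs hμ hVc hV hg hL ht hs hts h1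
    rw [← hν] at pl
    have hsk : s / (2 * (lam * (1 - s) - 2 * L * s)) = s * κ s := by simp only [κ]; ring
    rw [hsk, ← ofReal_integral_eq_lintegral_ofReal (i3 _ ht)
        (Filter.Eventually.of_forall fun _ => exp_nonneg _),
      ← ofReal_integral_eq_lintegral_ofReal (i4 _ (mul_nonneg hs.le hκs))
        (Filter.Eventually.of_forall fun _ => exp_nonneg _),
      show ν Set.univ = ENNReal.ofReal M from (ENNReal.ofReal_toReal (measure_ne_top ν _)).symm,
      ENNReal.ofReal_rpow_of_pos (integral_exp_pos (i3 _ ht)),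
      ENNReal.ofReal_rpow_of_pos hM, ← ENNReal.ofReal_mul
        (Real.rpow_nonneg (integral_exp_pos (i3 _ ht)).le _),
      ENNReal.ofReal_le_ofReal_iff (integral_exp_pos (i4 _ (mul_nonneg hs.le hκs))).le] at pl
    have pl2 := Real.log_le_log (mul_pos (Real.rpow_pos_of_pos (integral_exp_pos (i3 _ ht)) _)
      (Real.rpow_pos_of_pos hM _)) pl
    rw [Real.log_mul (Real.rpow_pos_of_pos (integral_exp_pos (i3 _ ht)) _).ne'
      (Real.rpow_pos_of_pos hM _).ne', Real.log_rpow (integral_exp_pos (i3 _ ht)),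
      Real.log_rpow hM] at pl2
    have lo := log_integral_exp_div_ge ht hts i0 i1 (i3 _ ht) hZ
    have hi := log_integral_exp_add_le (mul_nonneg hs.le hκs) (fun x => sq_nonneg ‖fderiv ℝ g x‖)
      hdA h2.le i0 i2 (i4 _ (mul_nonneg hs.le hκs)) hZ
    have hfin : s * (G / Z - Real.log Z + Real.log M) ≤
        s * (κ s * (F / Z) + s * (κ s * A ^ 2) ^ 2) := by
      change (1 - s) * Real.log Z + s * (G / Z) ≤ _ at lo
      change _ ≤ Real.log Z + s * κ s * (F / Z) + _ at hi
      change _ + s * Real.log M ≤ _ at pl2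
      linarith
    exact le_of_mul_le_mul_left hfin hs
  have i5 : Integrable (fun x => g x * rexp (g x) - (Real.log (Z / M) + 1) * rexp (g x)) ν :=
    i1.sub (i0.const_mul _)
  have heq : (fun x => entropyIntegrand (Z / M) (rexp (g x))) =
      fun x => g x * rexp (g x) - (Real.log (Z / M) + 1) * rexp (g x) + Z / M := by
    ext x; simp only [entropyIntegrand, Real.log_exp]; ring
  have i6 : Integrable (fun x => entropyIntegrand (Z / M) (rexp (g x))) ν := by
    rw [heq]; exact i5.add (integrable_const _)
  have hent : ∫ x, entropyIntegrand (Z / M) (rexp (g x)) ∂ν = G - Z * Real.log (Z / M) := by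
    rw [heq, integral_add i5 (integrable_const _),
      integral_sub i1 (i0.const_mul _), integral_const_mul, integral_const, smul_eq_mul]
    change G - (Real.log (Z / M) + 1) * Z + M * (Z / M) = _
    field_simp; ring
  rw [← ofReal_integral_eq_lintegral_ofReal i6 (Filter.Eventually.of_forall fun x =>
      entropyIntegrand_nonneg (div_pos hZ hM) (exp_nonneg _)),
    ← ofReal_integral_eq_lintegral_ofReal i2 (Filter.Eventually.of_forall fun x => by positivity),
    ← ENNReal.ofReal_mul (by positivity), hent, Real.log_div hZ.ne' hM.ne']
  refine ENNReal.ofReal_le_ofReal ?_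
  have := mul_le_mul_of_nonneg_left main hZ.le
  have h1 : Z * (G / Z - Real.log Z + Real.log M) = G - Z * (Real.log Z - Real.log M) := by
    field_simp; ring
  have h2 : Z * (1 / (2 * lam) * (F / Z)) = 1 / (2 * lam) * F := by field_simp
  linarith

end StronglyLogConcave

theorem entropy_le_of_hasCompactSupport_sub_const {E : Type*}
    [NormedAddCommGroup E] [InnerProductSpace ℝ E]
    [MeasurableSpace E] [BorelSpace E] {μ : Measure E} (hμ : PrekopaLeindler μ)
    {V h : E → ℝ} {lam : ℝ} (hlam : 0 < lam) (hVc : Continuous V) (hV : StronglyConvex lam V)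
    {ν : Measure E} (hν : ν = μ.withDensity fun x => ENNReal.ofReal (rexp (-V x)))
    [IsFiniteMeasure ν] (hν0 : ν ≠ 0) (hh : ContDiff ℝ 2 h) (hpos : ∀ x, 0 < h x) {ε : ℝ}
    (hsupp : HasCompactSupport fun x => h x - ε) :
    ∫⁻ x, ENNReal.ofReal (entropyIntegrand ((∫ y, h y ∂ν) / ν.real Set.univ) (h x)) ∂ν ≤
      ENNReal.ofReal (1 / (2 * lam)) * ∫⁻ x, ENNReal.ofReal (‖fderiv ℝ h x‖ ^ 2 / h x) ∂ν := by
  have hg : ContDiff ℝ 2 fun x => Real.log (h x) := hh.log fun x => (hpos x).ne'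
  have hgs : HasCompactSupport fun x => Real.log (h x) - Real.log ε :=
    hsupp.mono' fun x hx => subset_tsupport _ fun h0 => hx (by
      simp only [sub_eq_zero] at h0 ⊢; rw [h0])
  have hD : fderiv ℝ (fun x => Real.log (h x)) =
      fderiv ℝ fun x => Real.log (h x) - Real.log ε := by
    ext1 x; rw [fderiv_sub_const]
  have hDs : HasCompactSupport (fderiv ℝ fun x => Real.log (h x)) := hD ▸ hgs.fderiv ℝ
  have hDc : ContDiff ℝ 1 (fderiv ℝ fun x => Real.log (h x)) :=
    hg.fderiv_right (by norm_num)
  obtain ⟨L, hL⟩ := hDc.lipschitzWith_of_hasCompactSupport hDs (by norm_num)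
  obtain ⟨A, hA⟩ := hDs.exists_bound_of_continuous hDc.continuous
  obtain ⟨K, hK⟩ := hgs.exists_bound_of_continuous (hg.continuous.sub continuous_const)
  have key := entropy_exp_le_of_prekopaLeindler hμ hlam hVc hV
    (hg.differentiable (by norm_num)) hL (K := K + |Real.log ε|) (fun x => by
      have h1 := hK x
      rw [Real.norm_eq_abs] at h1
      have h2 := abs_sub_abs_le_abs_sub (Real.log (h x)) (Real.log ε)
      linarith) hA hν hν0
  simp only [Real.exp_log (hpos _)] at key
  refine key.trans (le_of_eq ?_)
  congr 1
  refine lintegral_congr fun x => ?_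
  rw [fderiv.log ((hh.differentiable (by norm_num)) x) (hpos x).ne', norm_smul, mul_pow,
    Real.norm_eq_abs, sq_abs]
  congr 1
  have := hpos x
  field_simp

theorem norm_sq_fderiv_cutoff_div_le {E : Type*} [NormedAddCommGroup E] [InnerProductSpace ℝ E]
    {f χ : E → ℝ} {x : E} (hf : DifferentiableAt ℝ f x)
    (hχ : DifferentiableAt ℝ χ x) (hf0 : ∀ y, 0 ≤ f y) (hχ0 : 0 ≤ χ x) (hχ1 : χ x ≤ 1) {ε d : ℝ}
    (hε : 0 < ε) (hd : ‖fderiv ℝ χ x‖ ≤ d) :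
    ‖fderiv ℝ (fun y => χ y ^ 2 * f y + ε) x‖ ^ 2 / (χ x ^ 2 * f x + ε) ≤
      2 * (‖fderiv ℝ f x‖ ^ 2 / f x) + 8 * d ^ 2 * f x := by
  have hD : fderiv ℝ (fun y => χ y ^ 2 * f y + ε) x =
      χ x ^ 2 • fderiv ℝ f x + f x • ((2 * χ x) • fderiv ℝ χ x) := by
    have := ((hχ.hasFDerivAt.pow 2).mul hf.hasFDerivAt).add_const ε
    simpa using this.fderiv
  rcases (hf0 x).eq_or_lt with h0 | hpos
  · have hmin : IsLocalMin f x := Filter.Eventually.of_forall fun y => by rw [← h0]; exact hf0 y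
    rw [hD, hmin.fderiv_eq_zero, ← h0]
    simp
  · have hn : ‖fderiv ℝ (fun y => χ y ^ 2 * f y + ε) x‖ ≤
        χ x ^ 2 * ‖fderiv ℝ f x‖ + f x * (2 * χ x * d) := by
      rw [hD]
      refine (norm_add_le _ _).trans ?_
      rw [norm_smul, norm_smul, norm_smul, Real.norm_of_nonneg (by positivity),
        Real.norm_of_nonneg hpos.le, Real.norm_of_nonneg (by positivity)]
      gcongr
    rw [div_le_iff₀ (by positivity)]
    set D := ‖fderiv ℝ f x‖
    have h1 : 2 * (D ^ 2 / f x) * (χ x ^ 2 * f x) = 2 * χ x ^ 2 * D ^ 2 := by field_simp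
    have h2 : χ x ^ 4 * D ^ 2 ≤ χ x ^ 2 * D ^ 2 := by
      gcongr 1
      exact pow_le_pow_of_le_one hχ0 hχ1 (by norm_num)
    have h3 : 0 ≤ (2 * (D ^ 2 / f x) + 8 * d ^ 2 * f x) * ε := by positivity
    calc _ ≤ (χ x ^ 2 * D + f x * (2 * χ x * d)) ^ 2 := pow_le_pow_left₀ (norm_nonneg _) hn 2
      _ ≤ 2 * (χ x ^ 4 * D ^ 2) + 8 * d ^ 2 * f x * (χ x ^ 2 * f x) := by
        nlinarith [sq_nonneg (χ x ^ 2 * D - f x * (2 * χ x * d))]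
      _ ≤ _ := by linarith

/-- Smooth compactly supported cutoff functions with gradient tending to zero. -/
theorem exists_cutoff_seq (E : Type*) [NormedAddCommGroup E] [InnerProductSpace ℝ E]
    [FiniteDimensional ℝ E] : ∃ (χ : ℕ → E → ℝ) (C : ℝ), (∀ k, ContDiff ℝ 2 (χ k)) ∧
    (∀ k, HasCompactSupport (χ k)) ∧ (∀ k x, 0 ≤ χ k x) ∧ (∀ k x, χ k x ≤ 1) ∧
    (∀ k x, ‖fderiv ℝ (χ k) x‖ ≤ C * (1 / ((k : ℝ) + 1))) ∧
    ∀ x, Filter.Tendsto (fun k => χ k x) Filter.atTop (nhds 1) := by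
  let η : ContDiffBump (0 : E) := ⟨1, 2, one_pos, one_lt_two⟩
  have hηc : ContDiff ℝ 2 (η : E → ℝ) := η.contDiff
  obtain ⟨C, hC⟩ := (η.hasCompactSupport.fderiv ℝ).exists_bound_of_continuous
    (hηc.continuous_fderiv (by norm_num))
  have hr : ∀ k : ℕ, 0 < 1 / ((k : ℝ) + 1) := fun k => Nat.one_div_pos_of_nat
  refine ⟨fun k x => η ((1 / ((k : ℝ) + 1)) • x), C, fun k => hηc.comp (contDiff_const_smul _),
    fun k => η.hasCompactSupport.comp_smul (hr k).ne', fun k x => η.nonneg, fun k x => η.le_one,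
    fun k x => ?_, fun x => ?_⟩
  · rw [fderiv_comp_smul, norm_smul, Real.norm_of_nonneg (hr k).le, mul_comm]
    exact mul_le_mul_of_nonneg_right (hC _) (hr k).le
  · have h0 : Filter.Tendsto (fun k : ℕ => (1 / ((k : ℝ) + 1)) • x) Filter.atTop (nhds 0) := by
      simpa using (tendsto_one_div_add_atTop_nhds_zero_nat (𝕜 := ℝ)).smul_const x
    have h1 := (hηc.continuous.tendsto 0).comp h0
    rwa [η.one_of_mem_closedBall (by simp [η])] at h1

/-- Entropy inequality for strongly log-concave measures. -/
theorem entropy_le_of_stronglyConvex {E : Type*} [NormedAddCommGroup E] [InnerProductSpace ℝ E]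
    [FiniteDimensional ℝ E] [MeasurableSpace E] [BorelSpace E] {μ : Measure E} (hμ : PrekopaLeindler μ)
    {V f : E → ℝ} {lam : ℝ} (hlam : 0 < lam) (hVc : Continuous V) (hV : StronglyConvex lam V)
    {ν : Measure E} (hν : ν = μ.withDensity fun x => ENNReal.ofReal (rexp (-V x)))
    [IsFiniteMeasure ν] (hν0 : ν ≠ 0) (hf : ContDiff ℝ 2 f) (hf0 : ∀ x, 0 ≤ f x)
    (hfi : Integrable f ν) (hfpos : 0 < ∫ x, f x ∂ν) :
    ∫⁻ x, ENNReal.ofReal (entropyIntegrand ((∫ y, f y ∂ν) / ν.real Set.univ) (f x)) ∂ν ≤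
      ENNReal.ofReal (1 / lam) * ∫⁻ x, ENNReal.ofReal (‖fderiv ℝ f x‖ ^ 2 / f x) ∂ν := by
  obtain ⟨χ, C, hχc, hχs, hχ0, hχ1, hχd, hχlim⟩ := exists_cutoff_seq E
  have hr : ∀ k : ℕ, 0 < 1 / ((k : ℝ) + 1) := fun k => Nat.one_div_pos_of_nat
  have hr1 : ∀ k : ℕ, 1 / ((k : ℝ) + 1) ≤ 1 := fun k => by
    rw [div_le_one (by positivity)]; linarith [k.cast_nonneg (α := ℝ)]
  let h : ℕ → E → ℝ := fun k x => χ k x ^ 2 * f x + 1 / ((k : ℝ) + 1)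
  have hhc : ∀ k, ContDiff ℝ 2 (h k) := fun k => (((hχc k).pow 2).mul hf).add contDiff_const
  have hhpos : ∀ k x, 0 < h k x := fun k x =>
    add_pos_of_nonneg_of_pos (mul_nonneg (sq_nonneg _) (hf0 x)) (hr k)
  have hhle : ∀ k x, h k x ≤ f x + 1 := fun k x =>
    add_le_add (mul_le_of_le_one_left (hf0 x) (pow_le_one₀ (hχ0 k x) (hχ1 k x))) (hr1 k)
  have hhs : ∀ k, HasCompactSupport fun x => h k x - 1 / ((k : ℝ) + 1) := fun k =>
    (hχs k).mono' fun x hx => subset_tsupport _ fun h0 => hx (by simp [h, h0])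
  have hhlim : ∀ x, Filter.Tendsto (fun k => h k x) Filter.atTop (nhds (f x)) := fun x => by
    simpa [h] using (((hχlim x).pow 2).mul_const (f x)).add tendsto_one_div_add_atTop_nhds_zero_nat
  have : NeZero ν := ⟨hν0⟩
  have hM : 0 < ν.real Set.univ := by
    simp [Measure.real, ENNReal.toReal_pos_iff, pos_iff_ne_zero, hν0]
  have hclim : Filter.Tendsto (fun k => (∫ y, h k y ∂ν) / ν.real Set.univ) Filter.atTop
      (nhds ((∫ y, f y ∂ν) / ν.real Set.univ)) := by
    refine Filter.Tendsto.div_const ?_ _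
    refine tendsto_integral_of_dominated_convergence (fun x => f x + 1)
      (fun k => (hhc k).continuous.aestronglyMeasurable) (hfi.add (integrable_const _))
      (fun k => Filter.Eventually.of_forall fun x => ?_) (Filter.Eventually.of_forall hhlim)
    rw [Real.norm_of_nonneg (hhpos k x).le]
    exact hhle k x
  set c := (∫ y, f y ∂ν) / ν.real Set.univ
  have hc : 0 < c := div_pos hfpos hM
  have hlim : ∀ x, Filter.Tendsto (fun k => ENNReal.ofReal
      (entropyIntegrand ((∫ y, h k y ∂ν) / ν.real Set.univ) (h k x))) Filter.atTop
      (nhds (ENNReal.ofReal (entropyIntegrand c (f x)))) := fun x => by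
    refine ENNReal.tendsto_ofReal ?_
    refine ((Filter.Tendsto.sub ?_ ((hhlim x).mul (hclim.log hc.ne'))).sub (hhlim x)).add hclim
    exact (Real.continuous_mul_log.tendsto (f x)).comp (hhlim x)
  have hmeas : ∀ k, Measurable fun x => ENNReal.ofReal
      (entropyIntegrand ((∫ y, h k y ∂ν) / ν.real Set.univ) (h k x)) := fun k => by
    have := (hhc k).continuous.measurable
    unfold entropyIntegrand
    fun_prop
  have hfm : Measurable f := hf.continuous.measurable
  have hdfm : Measurable fun x => ‖fderiv ℝ f x‖ :=
    (hf.continuous_fderiv (by norm_num)).norm.measurable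
  have hbound : ∀ k, ∫⁻ x, ENNReal.ofReal
      (entropyIntegrand ((∫ y, h k y ∂ν) / ν.real Set.univ) (h k x)) ∂ν ≤
      ENNReal.ofReal (1 / (2 * lam)) *
        (2 * ∫⁻ x, ENNReal.ofReal (‖fderiv ℝ f x‖ ^ 2 / f x) ∂ν +
          ENNReal.ofReal (8 * (C * (1 / ((k : ℝ) + 1))) ^ 2) * ∫⁻ x, ENNReal.ofReal (f x) ∂ν) := by
    intro k
    refine (entropy_le_of_hasCompactSupport_sub_const hμ hlam hVc hV hν hν0 (hhc k) (hhpos k)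
      (hhs k)).trans ?_
    gcongr
    rw [← lintegral_const_mul _ (by fun_prop), ← lintegral_const_mul _ (by fun_prop),
      ← lintegral_add_left (by fun_prop)]
    refine lintegral_mono fun x => ?_
    have h2 : (2 : ℝ≥0∞) = ENNReal.ofReal 2 := by simp
    rw [h2, ← ENNReal.ofReal_mul (by norm_num), ← ENNReal.ofReal_mul (by positivity),
      ← ENNReal.ofReal_add (by have := hf0 x; positivity) (by have := hf0 x; positivity)]
    exact ENNReal.ofReal_le_ofReal (norm_sq_fderiv_cutoff_div_le
      (hf.differentiable (by norm_num) x) ((hχc k).differentiable (by norm_num) x) hf0 (hχ0 k x)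
      (hχ1 k x) (hr k) (hχd k x))
  have hRlim : Filter.Tendsto (fun k : ℕ => ENNReal.ofReal (1 / (2 * lam)) *
        (2 * ∫⁻ x, ENNReal.ofReal (‖fderiv ℝ f x‖ ^ 2 / f x) ∂ν +
          ENNReal.ofReal (8 * (C * (1 / ((k : ℝ) + 1))) ^ 2) * ∫⁻ x, ENNReal.ofReal (f x) ∂ν))
      Filter.atTop (nhds (ENNReal.ofReal (1 / (2 * lam)) *
        (2 * ∫⁻ x, ENNReal.ofReal (‖fderiv ℝ f x‖ ^ 2 / f x) ∂ν))) := by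
    refine ENNReal.Tendsto.const_mul ?_ (Or.inr ENNReal.ofReal_ne_top)
    have h1 : Filter.Tendsto (fun k : ℕ => ENNReal.ofReal (8 * (C * (1 / ((k : ℝ) + 1))) ^ 2))
        Filter.atTop (nhds 0) := by
      have := ENNReal.tendsto_ofReal
        (((tendsto_one_div_add_atTop_nhds_zero_nat (𝕜 := ℝ)).const_mul C).pow 2 |>.const_mul 8)
      simpa using this
    have h2 := ENNReal.Tendsto.mul_const (b := ∫⁻ x, ENNReal.ofReal (f x) ∂ν) h1 (Or.inr (by
      rw [← ofReal_integral_eq_lintegral_ofReal hfi (Filter.Eventually.of_forall hf0)]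
      exact ENNReal.ofReal_ne_top))
    simpa using h2.const_add (2 * ∫⁻ x, ENNReal.ofReal (‖fderiv ℝ f x‖ ^ 2 / f x) ∂ν)
  calc _ = ∫⁻ x, Filter.liminf (fun k => ENNReal.ofReal
          (entropyIntegrand ((∫ y, h k y ∂ν) / ν.real Set.univ) (h k x))) Filter.atTop ∂ν :=
        lintegral_congr fun x => (hlim x).liminf_eq.symm
    _ ≤ _ := lintegral_liminf_le hmeas
    _ ≤ _ := Filter.liminf_le_liminf (Filter.Eventually.of_forall hbound)
    _ = _ := hRlim.liminf_eq
    _ = _ := by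
      rw [← mul_assoc]
      congr 1
      rw [show (2 : ℝ≥0∞) = ENNReal.ofReal 2 by simp, ← ENNReal.ofReal_mul (by positivity)]
      congr 1
      field_simp

theorem entFor_le_integral_entropyIntegrand {X : Type*} [MeasurableSpace X] {P : Measure X}
    [IsProbabilityMeasure P] {f : X → ℝ} (hf0 : ∀ x, 0 ≤ f x) (hf : Integrable f P)
    (hflog : Integrable (fun x => f x * Real.log (f x)) P) {c : ℝ} (hc : 0 < c) :
    entFor P f ≤ ∫ x, entropyIntegrand c (f x) ∂P := by
  have h : ∫ x, entropyIntegrand c (f x) ∂P =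
      (∫ x, f x * Real.log (f x) ∂P) - (∫ x, f x ∂P) * Real.log c - (∫ x, f x ∂P) + c := by
    have i1 : Integrable (fun x => f x * Real.log (f x) - f x * Real.log c) P :=
      hflog.sub (hf.mul_const _)
    have i2 : Integrable (fun x => f x * Real.log (f x) - f x * Real.log c - f x) P := i1.sub hf
    simp only [entropyIntegrand]
    rw [integral_add i2 (integrable_const _), integral_sub i1 hf,
      integral_sub hflog (hf.mul_const _), integral_mul_const]
    simp
  have h2 := entropyIntegrand_nonneg hc (integral_nonneg (μ := P) hf0)
  unfold entropyIntegrand at h2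
  rw [h, entFor]
  linarith

theorem inv_smul_eq_zero_or_isProbabilityMeasure {X : Type*} [MeasurableSpace X] (ν : Measure X) :
    (ν Set.univ)⁻¹ • ν = 0 ∨ (ν Set.univ ≠ 0 ∧ ν Set.univ ≠ ∞ ∧
      IsProbabilityMeasure ((ν Set.univ)⁻¹ • ν)) := by
  by_cases h0 : ν Set.univ = 0
  · left; rw [Measure.measure_univ_eq_zero.1 h0, smul_zero]
  by_cases h1 : ν Set.univ = ∞
  · left; simp [h1]
  · exact Or.inr ⟨h0, h1, ⟨by simp [ENNReal.inv_mul_cancel h0 h1]⟩⟩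

theorem withDensity_exp_neg_le {X : Type*} [MeasurableSpace X] (μ : Measure X) {V W : X → ℝ}
    (hV : Measurable V) {K : ℝ} (h : ∀ x, V x - W x ≤ K) :
    μ.withDensity (fun x => ENNReal.ofReal (rexp (-W x))) ≤
      ENNReal.ofReal (rexp K) • μ.withDensity fun x => ENNReal.ofReal (rexp (-V x)) := by
  rw [← withDensity_smul _ (by fun_prop)]
  refine withDensity_mono (Filter.Eventually.of_forall fun x => ?_)
  simp only [Pi.smul_apply, smul_eq_mul]
  rw [← ENNReal.ofReal_mul (exp_nonneg _), ← Real.exp_add]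
  exact ENNReal.ofReal_le_ofReal (Real.exp_le_exp.2 (by linarith [h x]))

/-- Logarithmic Sobolev inequality for bounded perturbations of strongly log-concave measures. -/
theorem entFor_gibbs_le {E : Type*} [NormedAddCommGroup E] [InnerProductSpace ℝ E]
    [FiniteDimensional ℝ E] [MeasurableSpace E] [BorelSpace E] {μ : Measure E}
    (hμ : PrekopaLeindler μ) {V W f I : E → ℝ} {lam K : ℝ} (hlam : 0 < lam) (hVc : Continuous V)
    (hWc : Continuous W) (hV : StronglyConvex lam V) (hVW : ∀ x, |W x - V x| ≤ K)
    {P ν : Measure E} (hν : ν = μ.withDensity fun x => ENNReal.ofReal (rexp (-W x)))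
    (hP : P = (ν Set.univ)⁻¹ • ν) (hf : ContDiff ℝ 2 f) (hf0 : ∀ x, 0 ≤ f x)
    (hfi : Integrable f P) (hflog : Integrable (fun x => f x * Real.log (f x)) P)
    (hI : ∀ x, ‖fderiv ℝ f x‖ ^ 2 / f x ≤ I x) (hIi : Integrable I P) :
    entFor P f ≤ 1 / (lam * rexp (-(2 * K))) * ∫ x, I x ∂P := by
  have hI0 : ∀ x, 0 ≤ I x := fun x => (div_nonneg (sq_nonneg _) (hf0 x)).trans (hI x)
  have hRHS : 0 ≤ 1 / (lam * rexp (-(2 * K))) * ∫ x, I x ∂P :=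
    mul_nonneg (by positivity) (integral_nonneg hI0)
  rcases inv_smul_eq_zero_or_isProbabilityMeasure ν with h | ⟨hν0, hνtop, hprob⟩
  · rw [hP, h]; simp [entFor]
  rw [← hP] at hprob
  set ν' := μ.withDensity fun x => ENNReal.ofReal (rexp (-V x)) with hν'
  set k := ENNReal.ofReal (rexp K)
  have hle : ν ≤ k • ν' := hν ▸ withDensity_exp_neg_le μ hVc.measurable fun x => by
    linarith [(abs_le.1 (hVW x)).1]
  have hle' : ν' ≤ k • ν := hν ▸ withDensity_exp_neg_le μ hWc.measurable fun x => by
    linarith [(abs_le.1 (hVW x)).2]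
  have hktop : k ≠ ∞ := ENNReal.ofReal_ne_top
  have : IsFiniteMeasure ν := ⟨lt_top_iff_ne_top.2 hνtop⟩
  have : IsFiniteMeasure (k • ν) := Measure.smul_finite ν hktop
  have : IsFiniteMeasure ν' := isFiniteMeasure_of_le (k • ν) hle'
  have hν'0 : ν' ≠ 0 := fun h => hν0 (by
    rw [h, smul_zero] at hle
    simpa using hle Set.univ)
  have hfν : Integrable f ν := by
    have : ν = ν Set.univ • P := by
      rw [hP, smul_smul, ENNReal.mul_inv_cancel hν0 hνtop, one_smul]
    rw [this]
    exact hfi.smul_measure hνtop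
  have hfν' : Integrable f ν' := (hfν.smul_measure hktop).mono_measure hle'
  rcases (show 0 ≤ ∫ x, f x ∂ν' from integral_nonneg hf0).eq_or_lt with h0 | hpos
  · have hz : f =ᵐ[ν'] 0 := (integral_eq_zero_iff_of_nonneg hf0 hfν').1 h0.symm
    have hz1 : f =ᵐ[P] 0 := by
      have h1 : P ≪ ν' := by
        rw [hP]
        exact (Measure.smul_absolutelyContinuous).trans
          ((Measure.absolutelyContinuous_of_le hle).trans Measure.smul_absolutelyContinuous)
      exact h1.ae_le hz
    have e1 : ∫ x, f x ∂P = 0 := by rw [integral_congr_ae hz1]; simp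
    have e2 : ∫ x, f x * Real.log (f x) ∂P = 0 := by
      rw [integral_congr_ae (g := 0) (hz1.mono fun x hx => by simp [hx])]; simp
    rw [entFor, e1, e2]
    simpa using hRHS
  have key := entropy_le_of_stronglyConvex hμ hlam hVc hV hν' hν'0 hf hf0 hfν' hpos
  have : NeZero ν' := ⟨hν'0⟩
  have hM : 0 < ν'.real Set.univ := by
    simp [Measure.real, ENNReal.toReal_pos_iff, pos_iff_ne_zero, hν'0]
  set c := (∫ y, f y ∂ν') / ν'.real Set.univ
  have hc : 0 < c := div_pos hpos hM
  refine (entFor_le_integral_entropyIntegrand hf0 hfi hflog hc).trans ?_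
  have hi : Integrable (fun x => entropyIntegrand c (f x)) P :=
    ((hflog.sub (hfi.mul_const _)).sub hfi).add (integrable_const c)
  have hfin : ENNReal.ofReal (∫ x, entropyIntegrand c (f x) ∂P) ≤
      ENNReal.ofReal (1 / (lam * rexp (-(2 * K))) * ∫ x, I x ∂P) := by
    have hconst : ENNReal.ofReal (1 / (lam * rexp (-(2 * K)))) =
        k * ENNReal.ofReal (1 / lam) * k := by
      rw [← ENNReal.ofReal_mul (exp_nonneg _), ← ENNReal.ofReal_mul (by positivity)]
      congr 1
      rw [Real.exp_neg, two_mul, Real.exp_add]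
      field_simp
    rw [ENNReal.ofReal_mul (by positivity), hconst, ofReal_integral_eq_lintegral_ofReal hi
      (Filter.Eventually.of_forall fun x => entropyIntegrand_nonneg hc (hf0 x)),
      ofReal_integral_eq_lintegral_ofReal hIi (Filter.Eventually.of_forall hI0), hP,
      lintegral_smul_measure, lintegral_smul_measure, smul_eq_mul, smul_eq_mul]
    calc (ν Set.univ)⁻¹ * ∫⁻ x, ENNReal.ofReal (entropyIntegrand c (f x)) ∂ν
        ≤ (ν Set.univ)⁻¹ * ∫⁻ x, ENNReal.ofReal (entropyIntegrand c (f x)) ∂(k • ν') := by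
          gcongr
      _ = (ν Set.univ)⁻¹ * (k * ∫⁻ x, ENNReal.ofReal (entropyIntegrand c (f x)) ∂ν') := by
          rw [lintegral_smul_measure, smul_eq_mul]
      _ ≤ (ν Set.univ)⁻¹ * (k * (ENNReal.ofReal (1 / lam) *
            ∫⁻ x, ENNReal.ofReal (‖fderiv ℝ f x‖ ^ 2 / f x) ∂ν')) := by gcongr
      _ ≤ (ν Set.univ)⁻¹ * (k * (ENNReal.ofReal (1 / lam) *
            ∫⁻ x, ENNReal.ofReal (I x) ∂(k • ν))) := by
          gcongr with x
          exact hI x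
      _ = _ := by
          rw [lintegral_smul_measure, smul_eq_mul]
          ring
  exact (ENNReal.ofReal_le_ofReal_iff hRHS).1 hfin

/-- A function with second derivative at least `lam` is strongly convex. -/
theorem stronglyConvex_of_le_deriv2 {φ : ℝ → ℝ} {lam : ℝ} (hφ : ContDiff ℝ 2 φ)
    (h : ∀ x, lam ≤ deriv (deriv φ) x) : StronglyConvex lam φ := by
  have hd : Differentiable ℝ φ := hφ.differentiable (by norm_num)
  have hd' : Differentiable ℝ (deriv φ) :=
    (hφ.iterate_deriv' 1 1).differentiable (by norm_num)
  have e1 : deriv (fun x => φ x - lam / 2 * x ^ 2) = fun x => deriv φ x - lam * x := by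
    ext x
    have h2 : HasDerivAt (fun x : ℝ => lam / 2 * x ^ 2) (lam * x) x :=
      ((hasDerivAt_pow 2 x).const_mul (lam / 2)).congr_deriv (by simp; ring)
    exact ((hd x).hasDerivAt.sub h2).deriv
  have e2 : ∀ x, deriv (fun x => deriv φ x - lam * x) x = deriv (deriv φ) x - lam := fun x => by
    have h2 : HasDerivAt (fun x : ℝ => lam * x) lam x :=
      ((hasDerivAt_id' x).const_mul lam).congr_deriv (mul_one lam)
    exact ((hd' x).hasDerivAt.sub h2).deriv
  have hconv : ConvexOn ℝ Set.univ fun x => φ x - lam / 2 * x ^ 2 := by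
    refine convexOn_univ_of_deriv2_nonneg (hd.sub (by fun_prop)) ?_ fun x => ?_
    · rw [e1]; exact hd'.sub (by fun_prop)
    · simp only [Function.iterate_succ, Function.iterate_zero, Function.comp_apply, id]
      rw [e1, e2]; linarith [h x]
  intro x y t s ht hs hts
  have := hconv.2 (Set.mem_univ x) (Set.mem_univ y) ht.le hs.le hts
  simp only [smul_eq_mul, Real.norm_eq_abs, sq_abs] at this ⊢
  obtain rfl : t = 1 - s := by linarith
  nlinarith

theorem StronglyConvex.sum_comp_isometry {F : Type*} [NormedAddCommGroup F] [NormedSpace ℝ F]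
    {N : ℕ} {φ : ℝ → ℝ} {lam : ℝ} (hφ : StronglyConvex lam φ) (a : Fin N → ℝ)
    (x₀ : EuclideanSpace ℝ (Fin N)) (ι : F →ₗᵢ[ℝ] EuclideanSpace ℝ (Fin N)) :
    StronglyConvex lam fun y => ∑ i, (φ ((x₀ + ι y) i) + a i * (x₀ + ι y) i) := by
  intro x y t s ht hs hts
  have hnorm : ‖x - y‖ ^ 2 = ∑ i, ‖(x₀ + ι x) i - (x₀ + ι y) i‖ ^ 2 := by
    rw [← ι.norm_map, EuclideanSpace.norm_sq_eq]
    simp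
  have hpt : x₀ + ι (t • x + s • y) = t • (x₀ + ι x) + s • (x₀ + ι y) := by
    obtain rfl : t = 1 - s := by linarith
    rw [map_add, map_smul, map_smul]; module
  simp only [hnorm, hpt, Finset.mul_sum]
  rw [← Finset.sum_add_distrib, ← Finset.sum_sub_distrib]
  refine Finset.sum_le_sum fun i _ => ?_
  have := hφ ((x₀ + ι x) i) ((x₀ + ι y) i) t s ht hs hts
  have e : (t • (x₀ + ι x) + s • (x₀ + ι y)) i = t * (x₀ + ι x) i + s * (x₀ + ι y) i := rfl
  rw [e]
  simp only [smul_eq_mul] at this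
  linarith

/-- A linear isometry onto the hyperplane of vectors with vanishing sum. -/
theorem exists_linearIsometry_range_eq_sum_zero (n : ℕ) :
    ∃ ι : EuclideanSpace ℝ (Fin n) →ₗᵢ[ℝ] EuclideanSpace ℝ (Fin (n + 1)),
      Set.range ι = {x | ∑ i, x i = 0} := by
  let v : EuclideanSpace ℝ (Fin (n + 1)) := WithLp.toLp 2 fun _ => 1
  have hv : v ≠ 0 := fun h => by simpa [v] using congrArg (fun x => x 0) h
  have : Fact (Module.finrank ℝ (EuclideanSpace ℝ (Fin (n + 1))) = n + 1) := ⟨by simp⟩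
  let b := OrthonormalBasis.fromOrthogonalSpanSingleton (𝕜 := ℝ) n hv
  refine ⟨(Submodule.subtypeₗᵢ _).comp b.repr.symm.toLinearIsometry, ?_⟩
  ext x
  have h1 : x ∈ (ℝ ∙ v)ᗮ ↔ ∑ i, x i = 0 := by
    rw [Submodule.mem_orthogonal_singleton_iff_inner_right]
    simp [v, PiLp.inner_apply]
  rw [Set.mem_ofPred_eq, ← h1]
  constructor
  · rintro ⟨y, rfl⟩
    exact (b.repr.symm y).2
  · intro hx
    exact ⟨b.repr ⟨x, hx⟩, by simp⟩

theorem PrekopaLeindler.smul {E : Type*} [AddCommGroup E] [Module ℝ E] [MeasurableSpace E]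
    {μ : Measure E} (hμ : PrekopaLeindler μ) (c : NNReal) : PrekopaLeindler (c • μ) := by
  intro u v w hu hv hw t s ht hs hts h
  have hc : ((c : ℝ≥0∞) ^ t) * (c : ℝ≥0∞) ^ s = c := by
    rw [← ENNReal.rpow_add_of_nonneg _ _ ht.le hs.le, hts, ENNReal.rpow_one]
  have h1 : ∀ f : E → ℝ≥0∞, ∫⁻ x, f x ∂(c • μ) = c * ∫⁻ x, f x ∂μ := fun f => by
    rw [show c • μ = (c : ℝ≥0∞) • μ from rfl, lintegral_smul_measure, smul_eq_mul]
  rw [h1, h1, h1, ENNReal.mul_rpow_of_nonneg _ _ ht.le, ENNReal.mul_rpow_of_nonneg _ _ hs.le,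
    mul_mul_mul_comm, hc]
  gcongr
  exact hμ u v w hu hv hw t s ht hs hts h

theorem prekopaLeindler_hausdorffMeasure (n : ℕ) :
    PrekopaLeindler (μH[(n : ℝ)] : Measure (EuclideanSpace ℝ (Fin n))) := by
  have : (μH[(n : ℝ)] : Measure (EuclideanSpace ℝ (Fin n))).IsAddHaarMeasure := by
    simpa using isAddHaarMeasure_hausdorffMeasure (E := EuclideanSpace ℝ (Fin n))
  rw [Measure.isAddLeftInvariant_eq_smul μH[(n : ℝ)] (volume : Measure (EuclideanSpace ℝ (Fin n)))]
  exact (prekopaLeindler_volume_euclideanSpace n).smul _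

theorem map_withDensity_comp {X Y : Type*} [MeasurableSpace X] [MeasurableSpace Y] {μ : Measure X}
    {Φ : X → Y} (hΦ : Measurable Φ) {ρ : Y → ℝ≥0∞} (hρ : Measurable ρ) :
    (μ.map Φ).withDensity ρ = (μ.withDensity fun x => ρ (Φ x)).map Φ := by
  ext s hs
  rw [withDensity_apply _ hs, Measure.map_apply hΦ hs, withDensity_apply _ (hΦ hs),
    setLIntegral_map hs hρ hΦ]

/-- The canonical ensemble in isometric coordinates on the hyperplane. -/
theorem canonEns_eq_map {ψ : ℝ → ℝ} (hψ : Continuous ψ) {n : ℕ} (a : Fin (n + 1) → ℝ) (m : ℝ)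
    {ι : EuclideanSpace ℝ (Fin n) →ₗᵢ[ℝ] EuclideanSpace ℝ (Fin (n + 1))}
    (hι : Set.range ι = {x | ∑ i, x i = 0}) {x₀ : EuclideanSpace ℝ (Fin (n + 1))}
    (hx₀ : ∑ i, x₀ i = ((n + 1 : ℕ) : ℝ) * m) {ν : Measure (EuclideanSpace ℝ (Fin n))}
    (hν : ν = (μH[(n : ℝ)]).withDensity fun y =>
      ENNReal.ofReal (rexp (-∑ i, (ψ ((x₀ + ι y) i) + a i * (x₀ + ι y) i)))) :
    canonEns ψ (n + 1) a m = ((ν Set.univ)⁻¹ • ν).map fun y => x₀ + ι y := by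
  have hΦ : Isometry fun y => x₀ + ι y := (IsometryEquiv.addLeft x₀).isometry.comp ι.isometry
  have hrange : Set.range (fun y => x₀ + ι y) = {x | ∑ i, x i = ((n + 1 : ℕ) : ℝ) * m} := by
    ext x
    have h1 : x ∈ Set.range (fun y => x₀ + ι y) ↔ x - x₀ ∈ Set.range ι := by
      simp [eq_sub_iff_add_eq']
    rw [h1, hι]
    simp [sub_eq_zero, hx₀]
  have hρ : Measurable fun x : EuclideanSpace ℝ (Fin (n + 1)) =>
      ENNReal.ofReal (rexp (-(∑ i, (ψ (x i) + a i * x i)))) := by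
    refine (Continuous.measurable ?_).ennreal_ofReal
    fun_prop
  have hdim : ((n + 1 : ℕ) : ℝ) - 1 = n := by push_cast; ring
  simp only [canonEns]
  rw [hdim, ← hrange, ← hΦ.map_hausdorffMeasure (Or.inl n.cast_nonneg),
    map_withDensity_comp hΦ.continuous.measurable hρ, ← hν,
    Measure.map_apply hΦ.continuous.measurable MeasurableSet.univ, Set.preimage_univ,
    Measure.map_smul]

theorem norm_sq_fderiv_comp_le {n N : ℕ} {ι : EuclideanSpace ℝ (Fin n) →ₗᵢ[ℝ]
    EuclideanSpace ℝ (Fin N)} (hι : ∀ y, ∑ i, ι y i = 0) (x₀ : EuclideanSpace ℝ (Fin N))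
    {f : EuclideanSpace ℝ (Fin N) → ℝ} (hf : Differentiable ℝ f) (y : EuclideanSpace ℝ (Fin n)) :
    ‖fderiv ℝ (fun y => f (x₀ + ι y)) y‖ ^ 2 ≤ ∑ i, (gradient f (x₀ + ι y) i -
      (∑ j, gradient f (x₀ + ι y) j) / (N : ℝ)) ^ 2 := by
  set G := gradient f (x₀ + ι y)
  set p : EuclideanSpace ℝ (Fin N) := WithLp.toLp 2 fun i => G i - (∑ j, G j) / (N : ℝ)
  have hp : ∑ i, (G i - (∑ j, G j) / (N : ℝ)) ^ 2 = ‖p‖ ^ 2 := by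
    rw [EuclideanSpace.norm_sq_eq]; simp [p]
  rw [hp]
  refine pow_le_pow_left₀ (norm_nonneg _) ?_ 2
  refine ContinuousLinearMap.opNorm_le_bound _ (norm_nonneg _) fun v => ?_
  have hD : HasFDerivAt (fun y => f (x₀ + ι y))
      ((fderiv ℝ f (x₀ + ι y)).comp ι.toContinuousLinearMap) y :=
    ((hf (x₀ + ι y)).hasFDerivAt).comp y
      (ι.toContinuousLinearMap.hasFDerivAt.const_add x₀)
  have h1 : fderiv ℝ (fun y => f (x₀ + ι y)) y v = inner ℝ p (ι v) := by
    rw [hD.fderiv]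
    have h2 : fderiv ℝ f (x₀ + ι y) (ι v) = inner ℝ G (ι v) := by
      simp [G, gradient]
    have h3 : inner ℝ G (ι v) = inner ℝ p (ι v) := by
      simp only [PiLp.inner_apply, p, RCLike.inner_apply, conj_trivial]
      simp only [mul_sub, Finset.sum_sub_distrib, ← Finset.sum_mul, hι]
      ring
    rw [← h3, ← h2]; rfl
  rw [h1, ← ι.norm_map v]
  exact norm_inner_le_norm p (ι v)

theorem fisherX_nonneg {N : ℕ} {f : EuclideanSpace ℝ (Fin N) → ℝ} (hf0 : ∀ x, 0 ≤ f x)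
    (x : EuclideanSpace ℝ (Fin N)) : 0 ≤ fisherX N f x := by
  unfold fisherX
  split_ifs
  · exact le_rfl
  · exact div_nonneg (Finset.sum_nonneg fun i _ => sq_nonneg _) (hf0 x)

theorem entFor_eq_zero_of_subsingleton {X : Type*} [MeasurableSpace X] [Subsingleton X]
    (P : Measure X) (hP : P = 0 ∨ IsProbabilityMeasure P) (f : X → ℝ) : entFor P f = 0 := by
  rcases hP with rfl | hP
  · simp [entFor]
  · obtain ⟨x⟩ := P.nonempty_of_neZero
    have hc : f = fun _ => f x := by ext y; rw [Subsingleton.elim y x]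
    rw [hc]
    simp [entFor]

theorem isLSI_canonEns_zero (ψ : ℝ → ℝ) (a : Fin 0 → ℝ) (m : ℝ) {ρ : ℝ} (hρ : 0 ≤ ρ) :
    IsLSI 0 (canonEns ψ 0 a m) ρ := by
  intro f _ hf0 _ _ _
  have h : canonEns ψ 0 a m = 0 ∨ IsProbabilityMeasure (canonEns ψ 0 a m) :=
    (inv_smul_eq_zero_or_isProbabilityMeasure _).imp id fun h => h.2.2
  rw [entFor_eq_zero_of_subsingleton _ h]
  exact mul_nonneg (by positivity) (integral_nonneg (fisherX_nonneg hf0))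

/-- Logarithmic Sobolev inequality for canonical ensembles on a nonempty index set. -/
theorem isLSI_canonEns_succ {ψ φ : ℝ → ℝ} {lam B : ℝ} (hlam : 0 < lam) (hψ : Continuous ψ)
    (hφ : Continuous φ) (hconv : StronglyConvex lam φ) (hB : ∀ x, |ψ x - φ x| ≤ B) (n : ℕ)
    (m : ℝ) (a : Fin (n + 1) → ℝ) :
    IsLSI (n + 1) (canonEns ψ (n + 1) a m) (lam * rexp (-(2 * (((n + 1 : ℕ) : ℝ) * B)))) := by
  obtain ⟨ι, hι⟩ := exists_linearIsometry_range_eq_sum_zero n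
  set x₀ : EuclideanSpace ℝ (Fin (n + 1)) := WithLp.toLp 2 fun _ => m
  have hx₀ : ∑ i, x₀ i = ((n + 1 : ℕ) : ℝ) * m := by simp [x₀]
  have hΦ : Isometry fun y => x₀ + ι y := (IsometryEquiv.addLeft x₀).isometry.comp ι.isometry
  have hemb : MeasurableEmbedding fun y => x₀ + ι y := hΦ.isClosedEmbedding.measurableEmbedding
  have hιc := ι.continuous
  intro f hf hf0 hfi hflog hfish
  rw [canonEns_eq_map hψ a m hι hx₀ rfl] at hfi hflog hfish ⊢
  rw [hemb.integrable_map_iff] at hfi hflog hfish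
  rw [entFor, hemb.integral_map, hemb.integral_map, hemb.integral_map]
  refine entFor_gibbs_le (prekopaLeindler_hausdorffMeasure n) hlam
    (V := fun y => ∑ i, (φ ((x₀ + ι y) i) + a i * (x₀ + ι y) i)) (by fun_prop)
    (by fun_prop) (hconv.sum_comp_isometry a x₀ ι) (fun y => ?_) rfl rfl
    (f := fun y => f (x₀ + ι y)) ?_ (fun y => hf0 _) hfi hflog
    (I := fun y => fisherX (n + 1) f (x₀ + ι y)) (fun y => ?_) hfish
  · rw [← Finset.sum_sub_distrib]
    refine (Finset.abs_sum_le_sum_abs _ _).trans ?_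
    calc _ ≤ ∑ _i : Fin (n + 1), B := Finset.sum_le_sum fun i _ => by
          simpa using hB ((x₀ + ι y) i)
      _ = _ := by simp
  · exact (contDiff_infty.1 hf 2).comp (contDiff_const.add ι.contDiff)
  · have hle := norm_sq_fderiv_comp_le (N := n + 1)
      (fun y => (hι.le ⟨y, rfl⟩ : ι y ∈ {x | ∑ i, x i = 0})) x₀
      (hf.differentiable (by simp)) y
    unfold fisherX
    split_ifs with h0
    · simp [h0]
    · exact div_le_div_of_nonneg_right hle (hf0 _)

/-- If `ψ` is a bounded perturbation of a strictly convex potential, then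
there exist `ρ > 0` and `c ≥ 0`, depending only on `ψ`, such that for every `N`, `m` and every
`a ∈ ℝ^N`, the canonical ensemble `μ_{N,a,m}` satisfies `LSI(ρ e^{-cN})`. -/
theorem statement8
    (ψ ψc δψ : ℝ → ℝ) (lam0 B : ℝ)
    (hlam0 : 0 < lam0) (hB : 0 ≤ B)
    (hsplit : ∀ x, ψ x = ψc x + δψ x)
    (hψc : ContDiff ℝ 2 ψc) (hδψ : ContDiff ℝ 2 δψ)
    (hconv : ∀ x, lam0 ≤ deriv (deriv ψc) x)
    (hb0 : ∀ x, |δψ x| ≤ B) (hb1 : ∀ x, |deriv δψ x| ≤ B)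
    (hb2 : ∀ x, |deriv (deriv δψ) x| ≤ B) :
    ∃ ρ c : ℝ, 0 < ρ ∧ 0 ≤ c ∧ ∀ (N : ℕ) (m : ℝ) (a : Fin N → ℝ),
      IsLSI N (canonEns ψ N a m) (ρ * Real.exp (-c * N)) := by
  refine ⟨lam0, 2 * B, hlam0, by positivity, fun N m a => ?_⟩
  have hψ : Continuous ψ := by
    rw [funext hsplit]; exact hψc.continuous.add hδψ.continuous
  cases N with
  | zero => exact isLSI_canonEns_zero ψ a m (by positivity)
  | succ n =>
    have := isLSI_canonEns_succ hlam0 hψ hψc.continuous (stronglyConvex_of_le_deriv2 hψc hconv)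
      (B := B) (fun x => by rw [hsplit, add_sub_cancel_left]; exact hb0 x) n m a
    convert this using 3
    ring
end
end

section
/- Let ψ be a bounded perturbation of a strictly convex potential and fix L > 0 and m ∈ ℝ. Then there exists α > 0, depending only on ψ, L and m, such that for every N ∈ ℕ and every a ∈ ℝ^N with max_i |a_i| ≤ L, ∫_{X_{N,m}} |x|² μ_{N,a,m}(dx) ≤ αN, where |x| is the Euclidean norm on ℝ^N. -/
open MeasureTheory ENNReal Real

noncomputable section

/-- A differentiable convex function on `ℝ` lies above its tangent lines. -/
lemma ConvexOn.tangent_line_le {f : ℝ → ℝ} (hf : ConvexOn ℝ Set.univ f)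
    (hd : Differentiable ℝ f) (m x : ℝ) : f m + deriv f m * (x - m) ≤ f x := by
  rcases lt_trichotomy m x with h | rfl | h
  · have := hf.deriv_le_slope (Set.mem_univ m) (Set.mem_univ x) h (hd m)
    rw [slope_def_field, le_div_iff₀ (by linarith)] at this
    linarith
  · simp
  · have := hf.slope_le_deriv (Set.mem_univ x) (Set.mem_univ m) h (hd m)
    rw [slope_def_field, div_le_iff₀ (by linarith)] at this
    linarith

/-- Halving the distance to `m` decreases a uniformly convex function quadratically, up to a
linear term. -/
lemma exists_slope_quadratic_le_sub_midpoint {f : ℝ → ℝ} {c : ℝ} (hf : ContDiff ℝ 2 f)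
    (hconv : ∀ x, c ≤ deriv (deriv f) x) (m : ℝ) :
    ∃ b : ℝ, ∀ x, b * (x - m) + 3 * c / 8 * (x - m) ^ 2 ≤ f x - f ((x + m) / 2) := by
  have hd : Differentiable ℝ f := hf.differentiable (by norm_num)
  have hd' : Differentiable ℝ (deriv f) :=
    ((contDiff_succ_iff_deriv (n := 1)).1 hf).2.2.differentiable (by norm_num)
  set h : ℝ → ℝ := fun x => f x - c / 2 * x ^ 2
  have h1 : ∀ x, HasDerivAt h (deriv f x - c * x) x := fun x => by
    have := (hd x).hasDerivAt.sub ((hasDerivAt_pow 2 x).const_mul (c / 2))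
    exact this.congr_deriv (by norm_num; ring)
  have h2 : deriv h = fun x => deriv f x - c * x := funext fun x => (h1 x).deriv
  have h3 : ∀ x, HasDerivAt (deriv h) (deriv (deriv f) x - c) x := fun x => by
    rw [h2]
    exact ((hd' x).hasDerivAt.sub ((hasDerivAt_id x).const_mul c)).congr_deriv (by simp)
  have hhd : Differentiable ℝ h := fun x => (h1 x).differentiableAt
  have hcv : ConvexOn ℝ Set.univ h :=
    convexOn_univ_of_deriv2_nonneg hhd (fun x => (h3 x).differentiableAt) fun x => by
      simp only [Function.iterate_succ, Function.iterate_zero, Function.comp_apply, id]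
      rw [(h3 x).deriv]
      linarith [hconv x]
  refine ⟨deriv h m / 2 + c / 2 * m, fun x => ?_⟩
  have t1 := hcv.tangent_line_le hhd m x
  have t2 := hcv.2 (Set.mem_univ x) (Set.mem_univ m) (by norm_num : (0 : ℝ) ≤ 1 / 2)
    (by norm_num : (0 : ℝ) ≤ 1 / 2) (by norm_num)
  simp only [smul_eq_mul] at t2
  rw [show (1 / 2 * x + 1 / 2 * m : ℝ) = (x + m) / 2 by ring] at t2
  simp only [h] at t1 t2 ⊢
  nlinarith

/-- The hyperplane of configurations with mean `m`. -/
def meanHyperplane (N : ℕ) (m : ℝ) : Set (EuclideanSpace ℝ (Fin N)) :=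
  {x | ∑ i, x i = (N : ℝ) * m}

lemma measurableSet_meanHyperplane (N : ℕ) (m : ℝ) : MeasurableSet (meanHyperplane N m) :=
  (isClosed_eq (by fun_prop) continuous_const).measurableSet

lemma homothety_half_apply {N : ℕ} (m : ℝ) (x : EuclideanSpace ℝ (Fin N)) (i : Fin N) :
    AffineMap.homothety (WithLp.toLp 2 fun _ : Fin N => m) (1 / 2 : ℝ) x i = (x i + m) / 2 := by
  simp [AffineMap.homothety_apply]
  ring

lemma lintegral_meanHyperplane_comp_homothety {N : ℕ} (hN : 1 ≤ N) (m : ℝ)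
    {G : EuclideanSpace ℝ (Fin N) → ℝ≥0∞} (hG : Measurable G) :
    ∫⁻ x in meanHyperplane N m,
        G (AffineMap.homothety (WithLp.toLp 2 fun _ : Fin N => m) (1 / 2 : ℝ) x)
          ∂(μH[(N : ℝ) - 1]) ≤
      ENNReal.ofReal (Real.exp N) * ∫⁻ x in meanHyperplane N m, G x ∂(μH[(N : ℝ) - 1]) := by
  have hd : (0 : ℝ) ≤ (N : ℝ) - 1 := by
    have : (1 : ℝ) ≤ N := by exact_mod_cast hN
    linarith
  set S := AffineMap.homothety (WithLp.toLp 2 fun _ : Fin N => m) (1 / 2 : ℝ)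
  have hX := measurableSet_meanHyperplane N m
  have hmem : ∀ x, S x ∈ meanHyperplane N m ↔ x ∈ meanHyperplane N m := fun x => by
    simp only [meanHyperplane, Set.mem_ofPred_eq, S, homothety_half_apply, ← Finset.sum_div,
      Finset.sum_add_distrib, Finset.sum_const, Finset.card_univ, Fintype.card_fin, nsmul_eq_mul]
    constructor <;> intro h <;> linarith
  have hSm : Measurable S := (AffineMap.homothety_continuous _ _).measurable
  have key : ∫⁻ x in meanHyperplane N m, G (S x) ∂(μH[(N : ℝ) - 1]) =
      ∫⁻ x, (meanHyperplane N m).indicator G x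
        ∂(Measure.map S (μH[(N : ℝ) - 1] : Measure (EuclideanSpace ℝ (Fin N)))) := by
    rw [lintegral_map (hG.indicator hX) hSm, ← lintegral_indicator hX]
    refine lintegral_congr fun x => ?_
    by_cases hx : x ∈ meanHyperplane N m
    · rw [Set.indicator_of_mem hx, Set.indicator_of_mem ((hmem x).2 hx)]
    · rw [Set.indicator_of_notMem hx, Set.indicator_of_notMem (mt (hmem x).1 hx)]
  rw [key, map_homothety_hausdorffMeasure hd _ (by norm_num), lintegral_smul_measure,
    lintegral_indicator hX, ENNReal.smul_def, smul_eq_mul]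
  gcongr
  rw [ENNReal.ofReal, ENNReal.coe_le_coe, ← NNReal.coe_le_coe,
    Real.coe_toNNReal _ (Real.exp_pos _).le]
  have h2 : (2 : ℝ) ≤ Real.exp 1 := by linarith [Real.add_one_le_exp 1]
  calc (((‖(1 / 2 : ℝ)‖₊⁻¹ ^ ((N : ℝ) - 1) : NNReal)) : ℝ) = (2 : ℝ) ^ ((N : ℝ) - 1) := by
        simp [NNReal.coe_rpow]
    _ ≤ (2 : ℝ) ^ (N : ℝ) := Real.rpow_le_rpow_of_exponent_le (by norm_num) (by linarith)
    _ ≤ (Real.exp 1) ^ (N : ℝ) := Real.rpow_le_rpow (by norm_num) h2 (by positivity)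
    _ = Real.exp N := by rw [← Real.exp_mul, one_mul]

/-- On the hyperplane of mean `m`, contracting towards the constant configuration lowers the
energy by a multiple of the squared distance, up to an error linear in `N`. -/
lemma energy_homothety_le {ψ ψc δψ : ℝ → ℝ} {lam0 B L m : ℝ} (hlam0 : 0 < lam0)
    (hsplit : ∀ x, ψ x = ψc x + δψ x) (hψc : ContDiff ℝ 2 ψc)
    (hconv : ∀ x, lam0 ≤ deriv (deriv ψc) x) (hb0 : ∀ x, |δψ x| ≤ B)
    {N : ℕ} {a : Fin N → ℝ} (ha : ∀ i, |a i| ≤ L) {x : EuclideanSpace ℝ (Fin N)}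
    (hx : x ∈ meanHyperplane N m) :
    lam0 / 8 * ∑ i, (x i - m) ^ 2 - N * (2 * B + L ^ 2 / (4 * lam0)) +
        ∑ i, (ψ ((x i + m) / 2) + a i * ((x i + m) / 2)) ≤
      ∑ i, (ψ (x i) + a i * x i) := by
  obtain ⟨b, hb⟩ := exists_slope_quadratic_le_sub_midpoint hψc hconv m
  have hzero : ∑ i, b * (x i - m) = 0 := by
    rw [← Finset.mul_sum, Finset.sum_sub_distrib]
    simp only [meanHyperplane, Set.mem_ofPred_eq] at hx
    simp [hx]
  have hsite : ∀ i, b * (x i - m) + (lam0 / 8 * (x i - m) ^ 2 - (2 * B + L ^ 2 / (4 * lam0))) +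
      (ψ ((x i + m) / 2) + a i * ((x i + m) / 2)) ≤ ψ (x i) + a i * x i := fun i => by
    have h1 := hb (x i)
    have h2 := abs_le.1 (hb0 (x i))
    have h3 := abs_le.1 (hb0 ((x i + m) / 2))
    have h4 : -(L * |x i - m|) ≤ a i * (x i - m) := by
      have := neg_abs_le (a i * (x i - m))
      rw [abs_mul] at this
      nlinarith [mul_le_mul_of_nonneg_right (ha i) (abs_nonneg (x i - m))]
    have h5 : 0 ≤ lam0 / 4 * |x i - m| ^ 2 - L * |x i - m| / 2 + L ^ 2 / (4 * lam0) := by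
      have : lam0 / 4 * |x i - m| ^ 2 - L * |x i - m| / 2 + L ^ 2 / (4 * lam0) =
          (lam0 * |x i - m| - L) ^ 2 / (4 * lam0) := by
        field_simp
        ring
      rw [this]
      positivity
    rw [sq_abs] at h5
    rw [hsplit, hsplit]
    linarith
  have := Finset.sum_le_sum fun i (_ : i ∈ Finset.univ) => hsite i
  rw [Finset.sum_add_distrib, Finset.sum_add_distrib, hzero, Finset.sum_sub_distrib,
    ← Finset.mul_sum] at this
  simp only [Finset.sum_const, Finset.card_univ, Fintype.card_fin, nsmul_eq_mul] at this
  linarith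

/-- Exponential moment bound for the canonical ensemble. -/
lemma lintegral_exp_canonEns_le_one {ψ ψc δψ : ℝ → ℝ} {lam0 B L m : ℝ} (hlam0 : 0 < lam0)
    (hsplit : ∀ x, ψ x = ψc x + δψ x) (hψc : ContDiff ℝ 2 ψc) (hψ : Continuous ψ)
    (hconv : ∀ x, lam0 ≤ deriv (deriv ψc) x) (hb0 : ∀ x, |δψ x| ≤ B)
    {N : ℕ} (hN : 1 ≤ N) {a : Fin N → ℝ} (ha : ∀ i, |a i| ≤ L) :
    ∫⁻ x, ENNReal.ofReal (Real.exp (lam0 / 8 * ∑ i, (x i - m) ^ 2 -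
      N * (2 * B + L ^ 2 / (4 * lam0) + 1))) ∂(canonEns ψ N a m) ≤ 1 := by
  set C := 2 * B + L ^ 2 / (4 * lam0)
  set G : EuclideanSpace ℝ (Fin N) → ℝ≥0∞ := fun x =>
    ENNReal.ofReal (Real.exp (-(∑ i, (ψ (x i) + a i * x i))))
  have hG : Measurable G := by
    refine ENNReal.measurable_ofReal.comp (Continuous.measurable ?_)
    fun_prop
  have hX := measurableSet_meanHyperplane N m
  change ∫⁻ x, _ ∂((((μH[(N : ℝ) - 1]).restrict (meanHyperplane N m)).withDensity G Set.univ)⁻¹ •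
    (((μH[(N : ℝ) - 1]).restrict (meanHyperplane N m)).withDensity G)) ≤ 1
  rw [lintegral_smul_measure, smul_eq_mul, withDensity_apply _ MeasurableSet.univ,
    Measure.restrict_univ]
  refine le_trans ?_ (ENNReal.inv_mul_le_one (∫⁻ x in meanHyperplane N m, G x ∂(μH[(N : ℝ) - 1])))
  refine mul_le_mul_right ?_ _
  rw [lintegral_withDensity_eq_lintegral_mul₀ hG.aemeasurable
    (Continuous.measurable (by fun_prop)).ennreal_ofReal.aemeasurable]
  calc ∫⁻ x in meanHyperplane N m, G x * ENNReal.ofReal (Real.exp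
          (lam0 / 8 * ∑ i, (x i - m) ^ 2 - N * (C + 1))) ∂(μH[(N : ℝ) - 1])
      ≤ ∫⁻ x in meanHyperplane N m, ENNReal.ofReal (Real.exp (-(N : ℝ))) *
          G (AffineMap.homothety (WithLp.toLp 2 fun _ : Fin N => m) (1 / 2 : ℝ) x)
          ∂(μH[(N : ℝ) - 1]) := by
        refine setLIntegral_mono' hX fun x hx => ?_
        have := energy_homothety_le hlam0 hsplit hψc hconv hb0 ha hx
        simp only [G, homothety_half_apply]
        rw [← ENNReal.ofReal_mul (Real.exp_pos _).le, ← ENNReal.ofReal_mul (Real.exp_pos _).le,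
          ← Real.exp_add, ← Real.exp_add]
        refine ENNReal.ofReal_le_ofReal (Real.exp_le_exp.2 ?_)
        simp only [C]
        linarith
    _ = ENNReal.ofReal (Real.exp (-(N : ℝ))) * ∫⁻ x in meanHyperplane N m,
          G (AffineMap.homothety (WithLp.toLp 2 fun _ : Fin N => m) (1 / 2 : ℝ) x)
          ∂(μH[(N : ℝ) - 1]) :=
        lintegral_const_mul _ (hG.comp (AffineMap.homothety_continuous _ _).measurable)
    _ ≤ ENNReal.ofReal (Real.exp (-(N : ℝ))) * (ENNReal.ofReal (Real.exp N) *
          ∫⁻ x in meanHyperplane N m, G x ∂(μH[(N : ℝ) - 1])) := by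
        gcongr
        exact lintegral_meanHyperplane_comp_homothety hN m hG
    _ = ∫⁻ x in meanHyperplane N m, G x ∂(μH[(N : ℝ) - 1]) := by
        rw [← mul_assoc, ← ENNReal.ofReal_mul (Real.exp_pos _).le, ← Real.exp_add]
        simp

lemma canonEns_univ_le_one (ψ : ℝ → ℝ) (N : ℕ) (a : Fin N → ℝ) (m : ℝ) :
    canonEns ψ N a m Set.univ ≤ 1 := by
  simp only [canonEns, Measure.smul_apply, smul_eq_mul]
  exact ENNReal.inv_mul_le_one _

/-- Uniform second-moment bound for the canonical ensemble: if `ψ` is a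
bounded perturbation of a strictly convex potential and `L > 0`, `m ∈ ℝ` are fixed, there is
`α > 0` depending only on `ψ`, `L`, `m` with `∫ |x|² dμ_{N,a,m} ≤ αN` whenever
`max |aᵢ| ≤ L`. -/
theorem statement13
    (ψ ψc δψ : ℝ → ℝ) (lam0 B L m : ℝ)
    (hlam0 : 0 < lam0) (hB : 0 ≤ B) (hL : 0 < L)
    (hsplit : ∀ x, ψ x = ψc x + δψ x)
    (hψc : ContDiff ℝ 2 ψc) (hδψ : ContDiff ℝ 2 δψ)
    (hconv : ∀ x, lam0 ≤ deriv (deriv ψc) x)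
    (hb0 : ∀ x, |δψ x| ≤ B) (hb1 : ∀ x, |deriv δψ x| ≤ B)
    (hb2 : ∀ x, |deriv (deriv δψ) x| ≤ B) :
    ∃ α : ℝ, 0 < α ∧ ∀ (N : ℕ) (a : Fin N → ℝ), (∀ i, |a i| ≤ L) →
      (∫ x, ∑ i, (x i) ^ 2 ∂(canonEns ψ N a m)) ≤ α * N := by
  have hψ : Continuous ψ := by
    rw [funext hsplit]
    exact hψc.continuous.add hδψ.continuous
  set C := 2 * B + L ^ 2 / (4 * lam0) with hC
  have hC0 : 0 ≤ C := by positivity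
  refine ⟨2 * m ^ 2 + 16 / lam0 * (C + 2), by positivity, fun N a ha => ?_⟩
  rcases Nat.eq_zero_or_pos N with rfl | hN
  · simp
  have hN1 : (1 : ℝ) ≤ N := by exact_mod_cast hN
  rw [integral_eq_lintegral_of_nonneg_ae
    (Filter.Eventually.of_forall fun x => Finset.sum_nonneg fun i _ => sq_nonneg _)
    (Continuous.aestronglyMeasurable (by fun_prop))]
  refine ENNReal.toReal_le_of_le_ofReal (by positivity) ?_
  set A : ℝ := N * (2 * m ^ 2 + 16 / lam0 * (C + 1))
  have hA : 0 ≤ A := by positivity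
  have hpt : ∀ x : EuclideanSpace ℝ (Fin N), ENNReal.ofReal (∑ i, (x i) ^ 2) ≤
      ENNReal.ofReal A + ENNReal.ofReal (16 / lam0) * ENNReal.ofReal (Real.exp
        (lam0 / 8 * ∑ i, (x i - m) ^ 2 - N * (C + 1))) := fun x => by
    rw [← ENNReal.ofReal_mul (by positivity), ← ENNReal.ofReal_add hA (by positivity)]
    refine ENNReal.ofReal_le_ofReal ?_
    have h1 : ∑ i, (x i) ^ 2 ≤ ∑ i, (2 * (x i - m) ^ 2 + 2 * m ^ 2) :=
      Finset.sum_le_sum fun i _ => by nlinarith [sq_nonneg (x i - 2 * m)]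
    rw [Finset.sum_add_distrib, ← Finset.mul_sum] at h1
    simp only [Finset.sum_const, Finset.card_univ, Fintype.card_fin, nsmul_eq_mul] at h1
    have h2 := mul_le_mul_of_nonneg_left
      (Real.add_one_le_exp (lam0 / 8 * ∑ i, (x i - m) ^ 2 - N * (C + 1)))
      (by positivity : (0 : ℝ) ≤ 16 / lam0)
    have h3 : 16 / lam0 * (lam0 / 8 * ∑ i, (x i - m) ^ 2 - N * (C + 1) + 1) =
        2 * ∑ i, (x i - m) ^ 2 - N * (16 / lam0 * (C + 1)) + 16 / lam0 := by
      field_simp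
      ring
    have h4 : 0 < 16 / lam0 := by positivity
    simp only [A]
    linarith
  calc ∫⁻ x, ENNReal.ofReal (∑ i, (x i) ^ 2) ∂(canonEns ψ N a m)
      ≤ ∫⁻ x, (ENNReal.ofReal A + ENNReal.ofReal (16 / lam0) * ENNReal.ofReal (Real.exp
        (lam0 / 8 * ∑ i, (x i - m) ^ 2 - N * (C + 1)))) ∂(canonEns ψ N a m) :=
        lintegral_mono hpt
    _ = ENNReal.ofReal A * canonEns ψ N a m Set.univ + ENNReal.ofReal (16 / lam0) *
        ∫⁻ x, ENNReal.ofReal (Real.exp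
          (lam0 / 8 * ∑ i, (x i - m) ^ 2 - N * (C + 1))) ∂(canonEns ψ N a m) := by
        rw [lintegral_add_left measurable_const, lintegral_const,
          lintegral_const_mul _ (Continuous.measurable (by fun_prop)).ennreal_ofReal]
    _ ≤ ENNReal.ofReal A * 1 + ENNReal.ofReal (16 / lam0) * 1 := by
        gcongr
        · exact canonEns_univ_le_one ψ N a m
        · exact lintegral_exp_canonEns_le_one hlam0 hsplit hψc hψ hconv hb0 hN ha
    _ = ENNReal.ofReal (A + 16 / lam0) := by
        rw [mul_one, mul_one, ENNReal.ofReal_add hA (by positivity)]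
    _ ≤ ENNReal.ofReal ((2 * m ^ 2 + 16 / lam0 * (C + 2)) * N) := by
        refine ENNReal.ofReal_le_ofReal ?_
        have h4 : 16 / lam0 * 1 ≤ 16 / lam0 * N :=
          mul_le_mul_of_nonneg_left hN1 (by positivity)
        simp only [A]
        linarith
end
end

section
/- Let ψ = ψ_c + δψ where ψ_c ∈ C²(ℝ) satisfies ψ_c''(x) ≥ λ₀ > 0 for all x and δψ is bounded. For σ ∈ ℝ let μ_σ(dx) = Z_σ^{-1} exp(σx − ψ(x)) dx be the tilted probability measure on ℝ, m(σ) = ∫ x μ_σ(dx) its mean and s(σ)² = ∫ (x − m(σ))² μ_σ(dx) its variance. Then there exists C < ∞, depending only on λ₀ and osc(δψ), such that s(σ)² ≤ C for all σ ∈ ℝ. -/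
open MeasureTheory ENNReal Real

noncomputable section

/-- The tilted probability measure `μ_σ(dx) = Z_σ⁻¹ exp(σx - ψ(x)) dx` on `ℝ`. -/
def tiltedMeas (ψ : ℝ → ℝ) (σ : ℝ) : Measure ℝ :=
  let ν : Measure ℝ := volume.withDensity fun x => ENNReal.ofReal (Real.exp (σ * x - ψ x))
  (ν Set.univ)⁻¹ • ν

/-- The mean `m(σ)` of the tilted measure `μ_σ`. -/
def tiltedMean (ψ : ℝ → ℝ) (σ : ℝ) : ℝ := ∫ x, x ∂(tiltedMeas ψ σ)

/-- A potential whose derivative `p` vanishes at `a` and grows at rate at least `l` lies above a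
parabola with vertex at `a`. -/
theorem parabola_le_of_monotone_deriv {φ p : ℝ → ℝ} {l a : ℝ}
    (hφ : ∀ x, HasDerivAt φ (p x) x) (hp : Monotone fun x => p x - l * x) (ha : p a = 0) (x : ℝ) :
    φ a + l / 2 * (x - a) ^ 2 ≤ φ x := by
  have hg : ∀ x, HasDerivAt (fun x => φ x - l / 2 * (x - a) ^ 2) (p x - l * (x - a)) x := by
    intro x
    refine ((hφ x).fun_sub
      ((((hasDerivAt_id' x).sub_const a).fun_pow 2).const_mul (l / 2))).congr_deriv ?_
    ring
  have hc : Continuous fun x => φ x - l / 2 * (x - a) ^ 2 :=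
    continuous_iff_continuousAt.2 fun x => (hg x).continuousAt
  rcases le_total a x with hx | hx
  · have hmono : MonotoneOn (fun x => φ x - l / 2 * (x - a) ^ 2) (Set.Ici a) := by
      refine monotoneOn_of_deriv_nonneg (convex_Ici a) hc.continuousOn
        (fun y _ => (hg y).differentiableAt.differentiableWithinAt) fun y hy => ?_
      rw [interior_Ici] at hy
      have h := hp hy.le
      simp only [ha] at h
      rw [(hg y).deriv]
      linarith
    have h := hmono Set.self_mem_Ici hx hx
    simp only [sub_self] at h
    linarith
  · have hanti : AntitoneOn (fun x => φ x - l / 2 * (x - a) ^ 2) (Set.Iic a) := by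
      refine antitoneOn_of_deriv_nonpos (convex_Iic a) hc.continuousOn
        (fun y _ => (hg y).differentiableAt.differentiableWithinAt) fun y hy => ?_
      rw [interior_Iic] at hy
      have h := hp hy.le
      simp only [ha] at h
      rw [(hg y).deriv]
      linarith
    have h := hanti hx Set.self_mem_Iic hx
    simp only [sub_self] at h
    linarith

theorem integrable_exp_neg_of_monotone_deriv {φ p : ℝ → ℝ} {l a : ℝ} (hl : 0 < l)
    (hφ : ∀ x, HasDerivAt φ (p x) x) (hp : Monotone fun x => p x - l * x) (ha : p a = 0) :
    Integrable fun x => Real.exp (-φ x) := by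
  have hc : Continuous φ := continuous_iff_continuousAt.2 fun x => (hφ x).continuousAt
  refine (((integrable_exp_neg_mul_sq (half_pos hl)).comp_sub_right a).const_mul
    (Real.exp (-φ a))).mono' (by fun_prop) (Filter.Eventually.of_forall fun x => ?_)
  rw [Real.norm_of_nonneg (Real.exp_nonneg _), ← Real.exp_add]
  have := parabola_le_of_monotone_deriv hφ hp ha x
  exact Real.exp_le_exp.2 (by linarith)

/-- Integration by parts against `x - a`; the boundary terms have a favourable sign. -/
theorem intervalIntegral_sq_mul_exp_neg_le {φ p : ℝ → ℝ} {l a : ℝ}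
    (hφ : ∀ x, HasDerivAt φ (p x) x) (hpc : Continuous p)
    (hp : Monotone fun x => p x - l * x) (ha : p a = 0) {R : ℝ} (hR : 0 ≤ R) :
    l * ∫ x in (a - R)..(a + R), (x - a) ^ 2 * Real.exp (-φ x) ≤
      ∫ x in (a - R)..(a + R), Real.exp (-φ x) := by
  have hc : Continuous φ := continuous_iff_continuousAt.2 fun x => (hφ x).continuousAt
  have hd : ∀ x, HasDerivAt (fun x => (x - a) * Real.exp (-φ x))
      (Real.exp (-φ x) - (x - a) * p x * Real.exp (-φ x)) x := by
    intro x
    refine (((hasDerivAt_id' x).sub_const a).fun_mul (hφ x).fun_neg.exp).congr_deriv ?_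
    ring
  have hftc := intervalIntegral.integral_eq_sub_of_hasDerivAt (a := a - R) (b := a + R)
    (fun x _ => hd x) (Continuous.intervalIntegrable (by fun_prop) _ _)
  rw [intervalIntegral.integral_sub (Continuous.intervalIntegrable (by fun_prop) _ _)
    (Continuous.intervalIntegrable (by fun_prop) _ _)] at hftc
  have hle : l * ∫ x in (a - R)..(a + R), (x - a) ^ 2 * Real.exp (-φ x) ≤
      ∫ x in (a - R)..(a + R), (x - a) * p x * Real.exp (-φ x) := by
    rw [← intervalIntegral.integral_const_mul]
    refine intervalIntegral.integral_mono_on (by linarith)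
      (Continuous.intervalIntegrable (by fun_prop) _ _)
      (Continuous.intervalIntegrable (by fun_prop) _ _) fun x _ => ?_
    rw [← mul_assoc]
    refine mul_le_mul_of_nonneg_right ?_ (Real.exp_nonneg _)
    rcases le_total a x with hx | hx
    · have h := hp hx
      simp only [ha] at h
      nlinarith
    · have h := hp hx
      simp only [ha] at h
      nlinarith
  have h1 : 0 ≤ R * Real.exp (-φ (a + R)) := by positivity
  have h2 : 0 ≤ R * Real.exp (-φ (a - R)) := by positivity
  linarith

theorem integral_sq_mul_exp_neg_le {φ p : ℝ → ℝ} {l a : ℝ} (hl : 0 < l)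
    (hφ : ∀ x, HasDerivAt φ (p x) x) (hpc : Continuous p)
    (hp : Monotone fun x => p x - l * x) (ha : p a = 0) :
    Integrable (fun x => (x - a) ^ 2 * Real.exp (-φ x)) ∧
      ∫ x, (x - a) ^ 2 * Real.exp (-φ x) ≤ (∫ x, Real.exp (-φ x)) / l := by
  have hc : Continuous φ := continuous_iff_continuousAt.2 fun x => (hφ x).continuousAt
  have hbot : Filter.Tendsto (fun n : ℕ => a - (n : ℝ)) Filter.atTop Filter.atBot :=
    Filter.tendsto_atBot_add_const_left _ a
      (Filter.tendsto_neg_atTop_atBot.comp tendsto_natCast_atTop_atTop)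
  have htop : Filter.Tendsto (fun n : ℕ => a + (n : ℝ)) Filter.atTop Filter.atTop :=
    Filter.tendsto_atTop_add_const_left _ a tendsto_natCast_atTop_atTop
  have hbound : ∀ n : ℕ, ∫ x in (a - (n : ℝ))..(a + (n : ℝ)), (x - a) ^ 2 * Real.exp (-φ x) ≤
      (∫ x, Real.exp (-φ x)) / l := by
    intro n
    have hn : (0 : ℝ) ≤ n := n.cast_nonneg
    rw [le_div_iff₀' hl]
    refine (intervalIntegral_sq_mul_exp_neg_le hφ hpc hp ha hn).trans ?_
    rw [intervalIntegral.integral_of_le (by linarith)]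
    exact setIntegral_le_integral (integrable_exp_neg_of_monotone_deriv hl hφ hp ha)
      (Filter.Eventually.of_forall fun x => Real.exp_nonneg _)
  have hint : Integrable (fun x => (x - a) ^ 2 * Real.exp (-φ x)) := by
    refine integrable_of_intervalIntegral_norm_bounded ((∫ x, Real.exp (-φ x)) / l)
      (fun n : ℕ => (Continuous.integrableOn_Ioc (by fun_prop))) hbot htop
      (Filter.Eventually.of_forall fun n => ?_)
    refine le_of_eq_of_le (intervalIntegral.integral_congr fun x _ => ?_) (hbound n)
    exact Real.norm_of_nonneg (by positivity)
  exact ⟨hint, le_of_tendsto' (intervalIntegral_tendsto_integral hint hbot htop) hbound⟩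

theorem exists_eq_zero_of_monotone_sub_mul {p : ℝ → ℝ} {l : ℝ} (hl : 0 < l) (hpc : Continuous p)
    (hp : Monotone fun x => p x - l * x) : ∃ a, p a = 0 := by
  have hR : l * (|p 0| / l) = |p 0| := by field_simp
  have hR0 : 0 ≤ |p 0| / l := by positivity
  refine mem_range_of_exists_le_of_exists_ge hpc ⟨-(|p 0| / l), ?_⟩ ⟨|p 0| / l, ?_⟩
  · have h := hp (neg_nonpos.2 hR0)
    simp only [mul_neg, hR] at h
    linarith [le_abs_self (p 0)]
  · have h := hp hR0
    simp only [hR] at h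
    linarith [neg_abs_le (p 0)]

theorem withDensity_ofReal_exp_univ {f : ℝ → ℝ} (hint : Integrable fun x => Real.exp (f x)) :
    (volume.withDensity fun x => ENNReal.ofReal (Real.exp (f x))) Set.univ =
      ENNReal.ofReal (∫ x, Real.exp (f x)) := by
  rw [withDensity_apply _ MeasurableSet.univ, Measure.restrict_univ,
    ofReal_integral_eq_lintegral_ofReal hint
      (Filter.Eventually.of_forall fun x => Real.exp_nonneg _)]

theorem integral_tiltedMeas {ψ : ℝ → ℝ} {σ : ℝ} (hψ : Measurable ψ)
    (hint : Integrable fun x => Real.exp (σ * x - ψ x)) (f : ℝ → ℝ) :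
    ∫ x, f x ∂(tiltedMeas ψ σ) =
      (∫ x, Real.exp (σ * x - ψ x))⁻¹ * ∫ x, Real.exp (σ * x - ψ x) * f x := by
  simp only [tiltedMeas]
  rw [integral_smul_measure, withDensity_ofReal_exp_univ hint, ENNReal.toReal_inv, ENNReal.toReal_ofReal
    (integral_nonneg fun x => Real.exp_nonneg _), integral_withDensity_eq_integral_toReal_smul
    (by fun_prop) (Filter.Eventually.of_forall fun x => ENNReal.ofReal_lt_top)]
  simp only [ENNReal.toReal_ofReal (Real.exp_nonneg _), smul_eq_mul]

theorem isProbabilityMeasure_tiltedMeas {ψ : ℝ → ℝ} {σ : ℝ}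
    (hint : Integrable fun x => Real.exp (σ * x - ψ x)) :
    IsProbabilityMeasure (tiltedMeas ψ σ) := by
  constructor
  simp only [tiltedMeas, Measure.smul_apply, smul_eq_mul]
  rw [withDensity_ofReal_exp_univ hint]
  exact ENNReal.inv_mul_cancel (ENNReal.ofReal_pos.2 (integral_exp_pos hint)).ne'
    ENNReal.ofReal_ne_top

/-- The mean minimizes the second moment about a point. -/
theorem integral_sq_sub_tiltedMean_le {ψ : ℝ → ℝ} {σ : ℝ}
    (hint : Integrable fun x => Real.exp (σ * x - ψ x)) (a : ℝ) :
    ∫ x, (x - tiltedMean ψ σ) ^ 2 ∂(tiltedMeas ψ σ) ≤ ∫ x, (x - a) ^ 2 ∂(tiltedMeas ψ σ) := by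
  have := isProbabilityMeasure_tiltedMeas hint
  have h := ProbabilityTheory.variance_le_expectation_sq (μ := tiltedMeas ψ σ)
    (X := fun x => x - a) (by fun_prop)
  rw [ProbabilityTheory.variance_sub_const (by fun_prop),
    ProbabilityTheory.variance_eq_integral (by fun_prop)] at h
  exact h

/-- Uniform bound on the variance of the tilted measures: if
`ψ = ψc + δψ` with `ψc'' ≥ λ₀ > 0` and `osc(δψ) ≤ B`, then there is `C`, depending only on
`λ₀` and the oscillation bound `B`, such that `s(σ)² ≤ C` for all `σ ∈ ℝ`. -/
theorem statement19 (lam0 B : ℝ) (hlam0 : 0 < lam0) (hB : 0 ≤ B) :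
    ∃ C : ℝ, ∀ ψ ψc δψ : ℝ → ℝ,
      (∀ x, ψ x = ψc x + δψ x) →
      ContDiff ℝ 2 ψc →
      (∀ x, lam0 ≤ deriv (deriv ψc) x) →
      Measurable δψ →
      (∀ x y, δψ x - δψ y ≤ B) →
      ∀ σ : ℝ,
        (∫ x, (x - tiltedMean ψ σ) ^ 2 ∂(tiltedMeas ψ σ)) ≤ C := by
  refine ⟨Real.exp (2 * B) / lam0, ?_⟩
  intro ψ ψc δψ hψ hψc hconv hmeas hosc σ
  have hd1 : Differentiable ℝ ψc := hψc.differentiable (by norm_num)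
  have hderiv : ContDiff ℝ 1 (deriv ψc) := ContDiff.deriv' hψc
  have hd2 : Differentiable ℝ (deriv ψc) := hderiv.differentiable (by norm_num)
  have hφ : ∀ x, HasDerivAt (fun x => ψc x - σ * x) (deriv ψc x - σ) x := by
    intro x
    simpa using (hd1 x).hasDerivAt.fun_sub ((hasDerivAt_id x).const_mul σ)
  have hpc : Continuous fun x => deriv ψc x - σ := hd2.continuous.sub continuous_const
  have hp : Monotone fun x => deriv ψc x - σ - lam0 * x := by
    have hq : ∀ x, HasDerivAt (fun x => deriv ψc x - σ - lam0 * x)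
        (deriv (deriv ψc) x - lam0) x := by
      intro x
      simpa using ((hd2 x).hasDerivAt.sub_const σ).fun_sub ((hasDerivAt_id x).const_mul lam0)
    refine monotone_of_deriv_nonneg (fun x => (hq x).differentiableAt) fun x => ?_
    rw [(hq x).deriv]
    exact sub_nonneg.2 (hconv x)
  obtain ⟨a, ha⟩ := exists_eq_zero_of_monotone_sub_mul hlam0 hpc hp
  have hint := integrable_exp_neg_of_monotone_deriv hlam0 hφ hp ha
  obtain ⟨hint2, hle⟩ := integral_sq_mul_exp_neg_le hlam0 hφ hpc hp ha
  have hψm : Measurable ψ := by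
    rw [funext hψ]
    exact hd1.continuous.measurable.add hmeas
  have hup : ∀ x, Real.exp (σ * x - ψ x) ≤
      Real.exp (B - δψ 0) * Real.exp (-(ψc x - σ * x)) := by
    intro x
    rw [← Real.exp_add, hψ]
    exact Real.exp_le_exp.2 (by linarith [hosc 0 x])
  have hlow : ∀ x, Real.exp (-B - δψ 0) * Real.exp (-(ψc x - σ * x)) ≤
      Real.exp (σ * x - ψ x) := by
    intro x
    rw [← Real.exp_add, hψ]
    exact Real.exp_le_exp.2 (by linarith [hosc x 0])
  have hintψ : Integrable fun x => Real.exp (σ * x - ψ x) := by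
    refine (hint.const_mul (Real.exp (B - δψ 0))).mono'
      (Measurable.aestronglyMeasurable (by fun_prop)) (Filter.Eventually.of_forall fun x => ?_)
    rw [Real.norm_of_nonneg (Real.exp_nonneg _)]
    exact hup x
  refine (integral_sq_sub_tiltedMean_le hintψ a).trans ?_
  rw [integral_tiltedMeas hψm hintψ, inv_mul_le_iff₀ (integral_exp_pos hintψ)]
  have hZ : Real.exp (-B - δψ 0) * ∫ x, Real.exp (-(ψc x - σ * x)) ≤
      ∫ x, Real.exp (σ * x - ψ x) := by
    rw [← integral_const_mul]
    exact integral_mono (hint.const_mul _) hintψ hlow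
  calc ∫ x, Real.exp (σ * x - ψ x) * (x - a) ^ 2
      ≤ ∫ x, Real.exp (B - δψ 0) * ((x - a) ^ 2 * Real.exp (-(ψc x - σ * x))) := by
        refine integral_mono_of_nonneg (Filter.Eventually.of_forall fun x => by positivity)
          (hint2.const_mul _) (Filter.Eventually.of_forall fun x => ?_)
        have := mul_le_mul_of_nonneg_right (hup x) (sq_nonneg (x - a))
        simp only
        linarith
    _ = Real.exp (B - δψ 0) * ∫ x, (x - a) ^ 2 * Real.exp (-(ψc x - σ * x)) :=
        integral_const_mul _ _
    _ ≤ Real.exp (B - δψ 0) * ((∫ x, Real.exp (-(ψc x - σ * x))) / lam0) := by gcongr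
    _ = Real.exp (2 * B) / lam0 *
          (Real.exp (-B - δψ 0) * ∫ x, Real.exp (-(ψc x - σ * x))) := by
        have : Real.exp (B - δψ 0) = Real.exp (2 * B) * Real.exp (-B - δψ 0) := by
          rw [← Real.exp_add]
          ring_nf
        rw [this]
        ring
    _ ≤ Real.exp (2 * B) / lam0 * ∫ x, Real.exp (σ * x - ψ x) := by gcongr
    _ = (∫ x, Real.exp (σ * x - ψ x)) * (Real.exp (2 * B) / lam0) := mul_comm _ _
end
end
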